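/- (Theorem 3, first sequence.) Let ε > 0 and α_n = 1/(n+1)^ε for n ≥ 0. Then for every f ∈ H^∞, the function f*α belongs to 𝔑 (i.e. ‖f*α‖_{H^∞} + Λ(f*α) < ∞), and the Toeplitz operator T_{f*α} is bounded on H^1 and on H^∞. -/

import Mathlib

open MeasureTheory Complex Metric Set
open scoped ENNReal

/-- Normalized Lebesgue (arc-length) measure on the unit circle `𝕋 ⊆ ℂ`. -/
noncomputable def circleMeasure : Measure ℂ :=
  Measure.map (fun θ : ℝ => Complex.exp (θ * Complex.I))
    ((ENNReal.ofReal (2 * Real.pi))⁻¹ • volume.restrict (Set.Ioc 0 (2 * Real.pi)))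

/-- `‖f‖_{H^p}^p = sup_{0<r<1} ∫_𝕋 |f(rζ)|^p dm(ζ)`, as a value in `[0,∞]`. -/
noncomputable def hardyNorm (p : ℝ) (f : ℂ → ℂ) : ℝ≥0∞ :=
  ⨆ r ∈ Set.Ioo (0 : ℝ) 1,
    ∫⁻ ζ, ENNReal.ofReal (‖f (↑r * ζ)‖ ^ p) ∂circleMeasure

/-- `‖f‖_{H^∞} = sup_{z ∈ 𝔻} |f(z)|`, as a value in `[0,∞]`. -/
noncomputable def eSupAbs (f : ℂ → ℂ) : ℝ≥0∞ :=
  ⨆ z ∈ Metric.ball (0 : ℂ) 1, ENNReal.ofReal ‖f z‖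

/-- `g` is the boundary function of `f` : radial limits a.e. on `𝕋`. -/
def IsBoundaryFn (f g : ℂ → ℂ) : Prop :=
  ∀ᵐ ζ ∂circleMeasure,
    Filter.Tendsto (fun r : ℝ => f (↑r * ζ)) (nhdsWithin 1 (Set.Iio 1)) (nhds (g ζ))

/-- `Λ(f) = ess sup_{η ∈ 𝕋} ∫_𝕋 |f*(ζ) - f*(η)|/|ζ - η| dm(ζ)` for a boundary function `f*`. -/
noncomputable def Lam (g : ℂ → ℂ) : ℝ≥0∞ :=
  essSup (fun η =>
    ∫⁻ ζ, ENNReal.ofReal (‖g ζ - g η‖ / ‖ζ - η‖) ∂circleMeasure)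
    circleMeasure

/-- Toeplitz operator: `(T_g h)(z) = ∫_𝕋 conj(g*(ζ)) h*(ζ)/(1 - conj(ζ) z) dm(ζ)`,
given boundary functions `gs = g*`, `hs = h*`. -/
noncomputable def toeplitz (gs hs : ℂ → ℂ) : ℂ → ℂ := fun z =>
  ∫ ζ, (starRingEnd ℂ) (gs ζ) * hs ζ / (1 - (starRingEnd ℂ) ζ * z) ∂circleMeasure

/-- `f̂(n)`, the `n`-th Taylor coefficient of `f` at `0`. -/
noncomputable def taylorCoeff (f : ℂ → ℂ) (n : ℕ) : ℂ :=
  iteratedDeriv n f 0 / n.factorial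

/-- `(f*α)(z) = ∑_{n≥0} f̂(n) α_n z^n`. -/
noncomputable def seqConv (f : ℂ → ℂ) (α : ℕ → ℝ) : ℂ → ℂ := fun z =>
  ∑' n : ℕ, taylorCoeff f n * (α n : ℂ) * z ^ n

/-- Partial sum `S_n(f)(z) = ∑_{k=0}^n f̂(k) z^k`. -/
noncomputable def taylorPartial (f : ℂ → ℂ) (n : ℕ) (z : ℂ) : ℂ :=
  ∑ k ∈ Finset.range (n + 1), taylorCoeff f k * z ^ k

/-- Cesàro mean `σ_n(f)(z) = (1/(n+1)) ∑_{k=0}^n S_k(f)(z)`. -/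
noncomputable def cesaro (f : ℂ → ℂ) (n : ℕ) (z : ℂ) : ℂ :=
  ((n : ℂ) + 1)⁻¹ * ∑ k ∈ Finset.range (n + 1), taylorPartial f k z


lemma cm_meas_exp : Measurable (fun θ : ℝ => Complex.exp (θ * Complex.I)) := by fun_prop

lemma cm_lintegral {F : ℂ → ℝ≥0∞} (hF : Measurable F) :
    ∫⁻ ζ, F ζ ∂circleMeasure = (ENNReal.ofReal (2 * Real.pi))⁻¹ *
      ∫⁻ θ in Set.Ioc 0 (2 * Real.pi), F (Complex.exp (θ * Complex.I)) := by
  unfold circleMeasure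
  rw [lintegral_map hF cm_meas_exp, lintegral_smul_measure]
  rfl

lemma cm_integral {F : ℂ → ℂ} (hF : AEStronglyMeasurable F circleMeasure) :
    ∫ ζ, F ζ ∂circleMeasure = (2 * Real.pi : ℂ)⁻¹ *
      ∫ θ in (0 : ℝ)..(2 * Real.pi), F (Complex.exp (θ * Complex.I)) := by
  unfold circleMeasure at *
  rw [integral_map cm_meas_exp.aemeasurable hF, integral_smul_measure,
    intervalIntegral.integral_of_le (by positivity)]
  rw [ENNReal.toReal_inv, ENNReal.toReal_ofReal (by positivity)]
  simp

instance cm_prob : IsProbabilityMeasure circleMeasure := by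
  constructor
  have := cm_lintegral (F := fun _ => 1) measurable_const
  simp only [lintegral_one] at this
  rw [this]
  simp only [Measure.restrict_apply_univ, Real.volume_Ioc, sub_zero]
  apply ENNReal.inv_mul_cancel
  · simp [Real.pi_pos]
  · exact ENNReal.ofReal_ne_top

lemma cm_norm : ∀ᵐ ζ ∂circleMeasure, ‖ζ‖ = 1 := by
  unfold circleMeasure
  rw [ae_map_iff cm_meas_exp.aemeasurable (measurableSet_eq_fun (by fun_prop) (by fun_prop))]
  exact Filter.Eventually.of_forall fun θ => Complex.norm_exp_ofReal_mul_I θ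

lemma cm_aesm {F : ℂ → ℂ} (hF : ContinuousOn F (sphere (0 : ℂ) 1)) :
    AEStronglyMeasurable F circleMeasure := by
  have h := hF.aestronglyMeasurable (μ := circleMeasure) isClosed_sphere.measurableSet
  rwa [Measure.restrict_eq_self_of_ae_mem] at h
  filter_upwards [cm_norm] with ζ hζ
  simpa using hζ

lemma cm_integrable {F : ℂ → ℂ} (hF : ContinuousOn F (sphere (0 : ℂ) 1)) :
    Integrable F circleMeasure := by
  obtain ⟨C, hC⟩ := (isCompact_sphere (0 : ℂ) 1).exists_bound_of_continuousOn hF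
  refine Integrable.of_bound (cm_aesm hF) C ?_
  filter_upwards [cm_norm] with ζ hζ
  exact hC ζ (by simpa using hζ)

lemma cm_orth (n m : ℕ) : ∫ ζ, ζ ^ n * (starRingEnd ℂ) (ζ ^ m) ∂circleMeasure =
    if n = m then 1 else 0 := by
  rw [cm_integral (by fun_prop)]
  have h1 : ∀ θ : ℝ, (Complex.exp (θ * Complex.I)) ^ n *
      (starRingEnd ℂ) ((Complex.exp (θ * Complex.I)) ^ m) =
      Complex.exp ((((n : ℤ) - (m : ℤ) : ℤ) : ℂ) * Complex.I * θ) := by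
    intro θ
    rw [map_pow, ← Complex.exp_conj, ← Complex.exp_nat_mul, ← Complex.exp_nat_mul,
      ← Complex.exp_add]
    congr 1
    simp
    ring
  simp_rw [h1]
  split_ifs with h
  · subst h
    simp
    field_simp
  · have h2 : ((((n : ℤ) - (m : ℤ) : ℤ) : ℂ) * Complex.I) ≠ 0 := by
      apply mul_ne_zero _ Complex.I_ne_zero
      rw [Int.cast_ne_zero]
      omega
    rw [integral_exp_mul_complex h2]
    have h3 : Complex.exp ((((n : ℤ) - (m : ℤ) : ℤ) : ℂ) * Complex.I * (2 * Real.pi : ℝ)) = 1 := by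
      rw [Complex.exp_eq_one_iff]
      exact ⟨(n : ℤ) - m, by push_cast; ring⟩
    rw [h3]
    simp

/-- power series with absolutely summable coefficients is continuous on the circle -/
lemma ps_cont {c : ℕ → ℂ} (hc : Summable fun n => ‖c n‖) :
    ContinuousOn (fun z : ℂ => ∑' n, c n * z ^ n) (closedBall 0 1) := by
  refine continuousOn_tsum (fun n => by fun_prop) hc ?_
  intro n z hz
  rw [norm_mul, norm_pow]
  have : ‖z‖ ≤ 1 := by simpa using hz
  exact mul_le_of_le_one_right (norm_nonneg _) (pow_le_one₀ (norm_nonneg _) this)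

lemma cm_swap {c : ℕ → ℂ} (hc : Summable fun n => ‖c n‖) {H : ℂ → ℂ}
    (hH : ContinuousOn H (sphere (0 : ℂ) 1)) :
    HasSum (fun n => c n * ∫ ζ, ζ ^ n * H ζ ∂circleMeasure)
      (∫ ζ, (∑' n, c n * ζ ^ n) * H ζ ∂circleMeasure) := by
  obtain ⟨C, hC⟩ := (isCompact_sphere (0 : ℂ) 1).exists_bound_of_continuousOn hH
  have hI : ∀ n, Integrable (fun ζ : ℂ => c n * ζ ^ n * H ζ) circleMeasure := fun n =>
    cm_integrable (by fun_prop)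
  have := hasSum_integral_of_summable_integral_norm (μ := circleMeasure)
    (F := fun n (ζ : ℂ) => c n * ζ ^ n * H ζ) hI ?_
  · have e1 : (fun n => c n * ∫ ζ, ζ ^ n * H ζ ∂circleMeasure) =
        fun n => ∫ ζ, c n * ζ ^ n * H ζ ∂circleMeasure := by
      ext n
      rw [← integral_const_mul]
      simp_rw [mul_assoc]
    have e2 : (∫ ζ, (∑' n, c n * ζ ^ n) * H ζ ∂circleMeasure) =
        ∫ ζ, (∑' n, c n * ζ ^ n * H ζ) ∂circleMeasure := by
      congr 1
      ext ζ
      rw [tsum_mul_right]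
    rw [e1, e2]
    exact this
  · refine Summable.of_nonneg_of_le (fun n => integral_nonneg fun ζ => norm_nonneg _) (fun n => ?_)
      (hc.mul_right C)
    calc ∫ ζ, ‖c n * ζ ^ n * H ζ‖ ∂circleMeasure ≤ ∫ ζ, ‖c n‖ * C ∂circleMeasure := by
          apply integral_mono_ae (hI n).norm (integrable_const _)
          filter_upwards [cm_norm] with ζ hζ
          simp only [norm_mul, norm_pow, hζ, one_pow, mul_one]
          exact mul_le_mul_of_nonneg_left (hC ζ (by simpa using hζ)) (norm_nonneg _)
      _ = ‖c n‖ * C := by simp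

lemma cm_parseval {c d : ℕ → ℂ} (hc : Summable fun n => ‖c n‖) (hd : Summable fun n => ‖d n‖) :
    HasSum (fun n => c n * (starRingEnd ℂ) (d n))
      (∫ ζ, (∑' n, c n * ζ ^ n) * (starRingEnd ℂ) (∑' n, d n * ζ ^ n) ∂circleMeasure) := by
  have hcont := (ps_cont hd).mono sphere_subset_closedBall
  convert cm_swap hc (H := fun ζ => (starRingEnd ℂ) (∑' n, d n * ζ ^ n))
    (Complex.continuous_conj.comp_continuousOn hcont) using 1
  ext m
  congr 1
  have h2 := (cm_swap hd (H := fun ζ => (starRingEnd ℂ) (ζ ^ m)) (by fun_prop)).tsum_eq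
  simp_rw [cm_orth] at h2
  simp only [mul_ite, mul_one, mul_zero, tsum_ite_eq] at h2
  rw [h2, ← integral_conj]
  congr 1
  ext ζ
  simp [mul_comm]

lemma cm_parseval_sq {c : ℕ → ℂ} (hc : Summable fun n => ‖c n‖) :
    HasSum (fun n => ‖c n‖ ^ 2) (∫ ζ, ‖∑' n, c n * ζ ^ n‖ ^ 2 ∂circleMeasure) := by
  have := cm_parseval hc hc
  simp_rw [Complex.mul_conj, Complex.normSq_eq_norm_sq] at this
  rw [integral_complex_ofReal] at this
  exact_mod_cast this

/-- property of a factorization of a polynomial into two `H²` functions -/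
def PolyFac (p F : Polynomial ℂ) (a b : ℂ → ℂ) : Prop :=
  DifferentiableOn ℂ a (ball 0 1) ∧ DifferentiableOn ℂ b (ball 0 1) ∧
  (∀ z ∈ ball (0 : ℂ) 1, p.eval z = a z * b z) ∧
  (∀ z ∈ ball (0 : ℂ) 1, ‖a z‖ ^ 2 ≤ ‖F.eval z‖) ∧
  (∀ z ∈ ball (0 : ℂ) 1, ‖b z‖ ^ 2 ≤ ‖F.eval z‖) ∧
  (∀ z : ℂ, ‖z‖ = 1 → ‖F.eval z‖ = ‖p.eval z‖)

lemma sqrt_lin {β : ℂ} (hβ : ‖β‖ ≤ 1) : ∃ s : ℂ → ℂ, DifferentiableOn ℂ s (ball 0 1) ∧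
    ∀ z ∈ ball (0 : ℂ) 1, s z ^ 2 = 1 - β * z ∧ s z ≠ 0 := by
  have hre : ∀ z ∈ ball (0 : ℂ) 1, 0 < (1 - β * z).re := by
    intro z hz
    have hz' : ‖z‖ < 1 := by simpa using hz
    have : ‖β * z‖ < 1 := by
      rw [norm_mul]
      nlinarith [norm_nonneg β, norm_nonneg z]
    have := (Complex.re_le_norm (β * z))
    simp only [Complex.sub_re, Complex.one_re]
    linarith
  refine ⟨fun z => (1 - β * z) ^ (1 / 2 : ℂ), ?_, ?_⟩
  · intro z hz
    apply DifferentiableAt.differentiableWithinAt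
    apply DifferentiableAt.cpow (by fun_prop) (by fun_prop)
    exact Or.inl (hre z hz)
  · intro z hz
    have hne : (1 - β * z) ≠ 0 := by
      intro h
      have := hre z hz
      rw [h] at this
      simp at this
    constructor
    · rw [← Complex.cpow_nat_mul]
      simp
    · simp [Complex.cpow_eq_zero_iff, hne]

lemma blaschke_le {α z : ℂ} (hα : ‖α‖ < 1) (hz : ‖z‖ < 1) :
    ‖z - α‖ ^ 2 ≤ ‖1 - (starRingEnd ℂ) α * z‖ ^ 2 := by
  have h : ‖1 - (starRingEnd ℂ) α * z‖ ^ 2 - ‖z - α‖ ^ 2 = (1 - ‖α‖ ^ 2) * (1 - ‖z‖ ^ 2) := by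
    simp only [← Complex.normSq_eq_norm_sq, Complex.normSq_apply]
    simp
    ring
  have h1 : 0 ≤ 1 - ‖α‖ ^ 2 := by nlinarith [norm_nonneg α]
  have h2 : 0 ≤ 1 - ‖z‖ ^ 2 := by nlinarith [norm_nonneg z]
  nlinarith [mul_nonneg h1 h2]

lemma blaschke_eq {α z : ℂ} (hz : ‖z‖ = 1) :
    ‖1 - (starRingEnd ℂ) α * z‖ = ‖z - α‖ := by
  have h : ‖1 - (starRingEnd ℂ) α * z‖ ^ 2 - ‖z - α‖ ^ 2 = (1 - ‖α‖ ^ 2) * (1 - ‖z‖ ^ 2) := by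
    simp only [← Complex.normSq_eq_norm_sq, Complex.normSq_apply]
    simp
    ring
  rw [hz] at h
  have : ‖1 - (starRingEnd ℂ) α * z‖ ^ 2 = ‖z - α‖ ^ 2 := by linarith
  exact (sq_eq_sq₀ (norm_nonneg _) (norm_nonneg _)).1 this

lemma polyFac_step {p F : Polynomial ℂ} {a b : ℂ → ℂ} (h : PolyFac p F a b) (α : ℂ) :
    ∃ F' a' b', PolyFac ((Polynomial.X - Polynomial.C α) * p) F' a' b' := by
  obtain ⟨ha, hb, hab, hFa, hFb, hF⟩ := h
  by_cases hα : ‖α‖ < 1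
  · obtain ⟨s, hs, hs2⟩ := sqrt_lin (β := (starRingEnd ℂ) α) (by simpa using hα.le)
    refine ⟨(1 - Polynomial.C ((starRingEnd ℂ) α) * Polynomial.X) * F,
      fun z => a z * (z - α) / s z, fun z => b z * s z, ?_, hb.mul hs, ?_, ?_, ?_, ?_⟩
    · exact (ha.mul (by fun_prop)).div hs fun z hz => (hs2 z hz).2
    · intro z hz
      have := (hs2 z hz).2
      simp [hab z hz]
      field_simp
    · intro z hz
      obtain ⟨h1, h2⟩ := hs2 z hz
      have h3 := blaschke_le hα (by simpa using hz)
      have h4 : 0 < ‖1 - (starRingEnd ℂ) α * z‖ := by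
        rw [← h1, norm_pow]; exact pow_pos (norm_pos_iff.2 h2) 2
      simp only [Polynomial.eval_mul, Polynomial.eval_sub, Polynomial.eval_one,
        Polynomial.eval_C, Polynomial.eval_X, norm_mul, norm_div, div_pow, mul_pow]
      rw [← norm_pow (s z), h1, div_le_iff₀ h4]
      have h5 := hFa z hz
      calc ‖a z‖ ^ 2 * ‖z - α‖ ^ 2 ≤ ‖F.eval z‖ * ‖1 - (starRingEnd ℂ) α * z‖ ^ 2 := by gcongr
        _ = _ := by ring
    · intro z hz
      obtain ⟨h1, h2⟩ := hs2 z hz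
      simp only [Polynomial.eval_mul, Polynomial.eval_sub, Polynomial.eval_one,
        Polynomial.eval_C, Polynomial.eval_X, norm_mul, mul_pow]
      rw [← norm_pow (s z), h1, mul_comm]
      gcongr
      exact hFb z hz
    · intro z hz
      simp only [Polynomial.eval_mul, Polynomial.eval_sub, Polynomial.eval_one,
        Polynomial.eval_C, Polynomial.eval_X, norm_mul]
      rw [hF z hz, blaschke_eq hz]
  · push Not at hα
    have hα0 : α ≠ 0 := by
      rintro rfl
      simp at hα
      linarith
    obtain ⟨s, hs, hs2⟩ := sqrt_lin (β := α⁻¹) (by rw [norm_inv]; exact inv_le_one_of_one_le₀ hα)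
    obtain ⟨t, ht⟩ : ∃ t : ℂ, t ^ 2 = -α := ⟨(-α) ^ (1 / 2 : ℂ), by
      rw [← Complex.cpow_nat_mul]; simp⟩
    have hw : ∀ z ∈ ball (0 : ℂ) 1, (t * s z) ^ 2 = z - α := by
      intro z hz
      rw [mul_pow, ht, (hs2 z hz).1]
      field_simp
      ring
    have hws : DifferentiableOn ℂ (fun z => t * s z) (ball 0 1) := hs.const_mul t
    refine ⟨(Polynomial.X - Polynomial.C α) * F,
      fun z => a z * (t * s z), fun z => b z * (t * s z), ha.mul hws, hb.mul hws, ?_, ?_, ?_, ?_⟩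
    · intro z hz
      simp only [Polynomial.eval_mul, Polynomial.eval_sub,
        Polynomial.eval_C, Polynomial.eval_X, hab z hz, ← hw z hz]
      ring
    · intro z hz
      simp only [Polynomial.eval_mul, Polynomial.eval_sub,
        Polynomial.eval_C, Polynomial.eval_X]
      rw [← hw z hz, norm_mul (_ ^ 2) _, norm_pow (t * s z), norm_mul _ (t * s z), mul_pow, mul_comm]
      gcongr
      exact hFa z hz
    · intro z hz
      simp only [Polynomial.eval_mul, Polynomial.eval_sub,
        Polynomial.eval_C, Polynomial.eval_X]
      rw [← hw z hz, norm_mul (_ ^ 2) _, norm_pow (t * s z), norm_mul _ (t * s z), mul_pow, mul_comm]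
      gcongr
      exact hFb z hz
    · intro z hz
      simp only [Polynomial.eval_mul, norm_mul, hF z hz]

lemma polyFac_exists (p : Polynomial ℂ) : ∃ F a b, PolyFac p F a b := by
  rw [(IsAlgClosed.splits p).eq_prod_roots]
  generalize p.leadingCoeff = c
  induction p.roots using Multiset.induction_on with
  | empty =>
    obtain ⟨t, ht⟩ : ∃ t : ℂ, t ^ 2 = c := ⟨c ^ (1 / 2 : ℂ), by
      rw [← Complex.cpow_nat_mul]; simp⟩
    refine ⟨Polynomial.C c, fun _ => t, fun _ => t, by fun_prop, by fun_prop, ?_, ?_, ?_, ?_⟩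
    · intro z _
      simp [← ht, sq]
    · intro z _
      simp [← ht]
    · intro z _
      simp [← ht]
    · intro z _
      simp
  | cons α s ih =>
    obtain ⟨F, a, b, h⟩ := ih
    obtain ⟨F', a', b', h'⟩ := polyFac_step h α
    refine ⟨F', a', b', ?_⟩
    convert h' using 1
    rw [Multiset.map_cons, Multiset.prod_cons]
    ring

lemma taylor_hasSum {h : ℂ → ℂ} (hh : DifferentiableOn ℂ h (ball 0 1)) {z : ℂ}
    (hz : z ∈ ball (0 : ℂ) 1) : HasSum (fun n => taylorCoeff h n * z ^ n) (h z) := by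
  have := Complex.hasSum_taylorSeries_on_ball (f := h) (c := 0) (r := 1) (by simpa using hh)
    (z := z) (by simpa using hz)
  have e : (fun n => taylorCoeff h n * z ^ n) =
      fun n : ℕ => ((n.factorial : ℂ)⁻¹) • (z - 0) ^ n • iteratedDeriv n h 0 := by
    ext n
    simp [taylorCoeff]
    ring
  rw [e]
  exact this

lemma taylor_summable {h : ℂ → ℂ} (hh : DifferentiableOn ℂ h (ball 0 1)) {r : ℝ}
    (hr0 : 0 ≤ r) (hr : r < 1) : Summable (fun n => ‖taylorCoeff h n * (r : ℂ) ^ n‖) :=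
  (taylor_hasSum hh (z := (r : ℂ)) (by simpa [abs_of_nonneg hr0] using hr)).summable.norm

lemma taylor_dilate {h : ℂ → ℂ} (hh : DifferentiableOn ℂ h (ball 0 1)) {r : ℝ}
    (hr0 : 0 ≤ r) (hr : r < 1) {z : ℂ} (hz : ‖z‖ ≤ 1) :
    h (r * z) = ∑' n, taylorCoeff h n * (r : ℂ) ^ n * z ^ n := by
  rw [← (taylor_hasSum hh (z := (r : ℂ) * z) ?_).tsum_eq]
  · congr 1
    ext n
    rw [mul_pow, mul_assoc]
  · simp [abs_of_nonneg hr0]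
    nlinarith [norm_nonneg z]

lemma dilate_cont {h : ℂ → ℂ} (hh : DifferentiableOn ℂ h (ball 0 1)) {r : ℝ}
    (hr0 : 0 ≤ r) (hr : r < 1) : ContinuousOn (fun z => h (r * z)) (closedBall 0 1) := by
  apply hh.continuousOn.comp (by fun_prop)
  intro z hz
  have hz : ‖z‖ ≤ 1 := by simpa using hz
  simp [abs_of_nonneg hr0]
  nlinarith [norm_nonneg z]

/-- coefficients bound from means on circles `r < 1` -/
lemma coeff_bound {a : ℂ → ℂ} (ha : DifferentiableOn ℂ a (ball 0 1)) {F : Polynomial ℂ}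
    (hF : ∀ z ∈ ball (0 : ℂ) 1, ‖a z‖ ^ 2 ≤ ‖F.eval z‖) (N : ℕ) :
    ∑ n ∈ Finset.range N, ‖taylorCoeff a n‖ ^ 2 ≤ ∫ ζ, ‖F.eval ζ‖ ∂circleMeasure := by
  have key : ∀ r ∈ Ioo (0 : ℝ) 1, ∑ n ∈ Finset.range N, ‖taylorCoeff a n * (r : ℂ) ^ n‖ ^ 2 ≤
      ∫ ζ, ‖F.eval ((r : ℂ) * ζ)‖ ∂circleMeasure := by
    intro r hr
    have hs := taylor_summable ha hr.1.le hr.2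
    have hp := cm_parseval_sq hs
    refine (hp.summable.sum_le_tsum _ (fun _ _ => by positivity)).trans ?_
    rw [hp.tsum_eq]
    apply integral_mono_of_nonneg
    · exact Filter.Eventually.of_forall fun _ => by positivity
    · exact (cm_integrable (F := fun ζ => F.eval ((r : ℂ) * ζ)) (by fun_prop)).norm
    · filter_upwards [cm_norm] with ζ hζ
      have := taylor_dilate ha hr.1.le hr.2 hζ.le
      rw [← this]
      apply hF
      simp [hζ, abs_of_pos hr.1, hr.2]
  have t1 : Filter.Tendsto (fun r : ℝ => ∑ n ∈ Finset.range N, ‖taylorCoeff a n * (r : ℂ) ^ n‖ ^ 2)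
      (nhdsWithin 1 (Iio 1)) (nhds (∑ n ∈ Finset.range N, ‖taylorCoeff a n * ((1 : ℝ) : ℂ) ^ n‖ ^ 2)) := by
    apply Filter.Tendsto.mono_left _ nhdsWithin_le_nhds
    apply Continuous.tendsto
    fun_prop
  have t2 : Filter.Tendsto (fun r : ℝ => ∫ ζ, ‖F.eval ((r : ℂ) * ζ)‖ ∂circleMeasure)
      (nhdsWithin 1 (Iio 1)) (nhds (∫ ζ, ‖F.eval (((1 : ℝ) : ℂ) * ζ)‖ ∂circleMeasure)) := by
    obtain ⟨C, hC⟩ := (isCompact_closedBall (0 : ℂ) 1).exists_bound_of_continuousOn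
      (f := fun z => F.eval z) (by fun_prop)
    apply tendsto_integral_filter_of_dominated_convergence (fun _ => C)
    · exact Filter.Eventually.of_forall fun r =>
        (cm_integrable (F := fun ζ => F.eval ((r : ℂ) * ζ)) (by fun_prop)).norm.1
    · filter_upwards [Ioo_mem_nhdsLT (show (0 : ℝ) < 1 by norm_num)] with r hr
      filter_upwards [cm_norm] with ζ hζ
      simp only [norm_norm]
      apply hC
      simp [hζ, abs_of_pos hr.1, hr.2.le]
    · exact integrable_const _
    · refine Filter.Eventually.of_forall fun ζ => ?_
      apply Filter.Tendsto.mono_left _ nhdsWithin_le_nhds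
      apply Continuous.tendsto (f := fun r : ℝ => ‖F.eval ((r : ℂ) * ζ)‖)
      fun_prop
  have := le_of_tendsto_of_tendsto t1 t2
    (by filter_upwards [Ioo_mem_nhdsLT (show (0 : ℝ) < 1 by norm_num)] with r hr using key r hr)
  simpa using this

lemma poly_coeffs (p : Polynomial ℂ) : ∃ a b : ℕ → ℂ,
    (∀ N, ∑ n ∈ Finset.range N, ‖a n‖ ^ 2 ≤ ∫ ζ, ‖p.eval ζ‖ ∂circleMeasure) ∧
    (∀ N, ∑ n ∈ Finset.range N, ‖b n‖ ^ 2 ≤ ∫ ζ, ‖p.eval ζ‖ ∂circleMeasure) ∧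
    ∀ z ∈ ball (0 : ℂ) 1, p.eval z = (∑' n, a n * z ^ n) * (∑' n, b n * z ^ n) := by
  obtain ⟨F, a, b, ha, hb, hab, hFa, hFb, hF⟩ := polyFac_exists p
  have hI : ∫ ζ, ‖p.eval ζ‖ ∂circleMeasure = ∫ ζ, ‖F.eval ζ‖ ∂circleMeasure := by
    apply integral_congr_ae
    filter_upwards [cm_norm] with ζ hζ using (hF ζ hζ).symm
  refine ⟨taylorCoeff a, taylorCoeff b, fun N => ?_, fun N => ?_, fun z hz => ?_⟩
  · rw [hI]; exact coeff_bound ha hFa N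
  · rw [hI]; exact coeff_bound hb hFb N
  · rw [hab z hz, (taylor_hasSum ha hz).tsum_eq, (taylor_hasSum hb hz).tsum_eq]

lemma approx_poly {h : ℂ → ℂ} (hh : DifferentiableOn ℂ h (ball 0 1)) {r : ℝ}
    (hr0 : 0 ≤ r) (hr : r < 1) {η : ℝ} (hη : 0 < η) :
    ∃ p : Polynomial ℂ, ∀ z : ℂ, ‖z‖ ≤ 1 → ‖p.eval z - h (r * z)‖ ≤ η := by
  have hu := tendstoUniformlyOn_tsum_nat (f := fun n (z : ℂ) => taylorCoeff h n * (r : ℂ) ^ n * z ^ n)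
    (s := closedBall 0 1) (taylor_summable hh hr0 hr) (by
      intro n z hz
      have hz : ‖z‖ ≤ 1 := by simpa using hz
      rw [norm_mul _ (z ^ n), norm_pow z]
      exact mul_le_of_le_one_right (norm_nonneg _) (pow_le_one₀ (norm_nonneg _) hz))
  obtain ⟨N, hN⟩ := (Metric.tendstoUniformlyOn_iff.1 hu η hη).exists
  refine ⟨∑ n ∈ Finset.range N, Polynomial.C (taylorCoeff h n * (r : ℂ) ^ n) * Polynomial.X ^ n,
    fun z hz => ?_⟩
  have := hN z (by simpa using hz)
  rw [← taylor_dilate hh hr0 hr hz, dist_comm, dist_eq_norm] at this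
  simpa [Polynomial.eval_finsetSum] using this.le

lemma sq_bound {a : ℕ → ℂ} {L : ℝ} (ha : ∀ N, ∑ n ∈ Finset.range N, ‖a n‖ ^ 2 ≤ L) (n : ℕ) :
    ‖a n‖ ≤ Real.sqrt L := by
  apply Real.le_sqrt_of_sq_le
  exact (Finset.single_le_sum (f := fun n => ‖a n‖ ^ 2) (fun _ _ => by positivity)
    (Finset.self_mem_range_succ n)).trans (ha (n + 1))

lemma ultra_lim {L : ℝ} (a : ℕ → ℕ → ℂ) (ha : ∀ k N, ∑ n ∈ Finset.range N, ‖a k n‖ ^ 2 ≤ L) :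
    ∃ A : ℕ → ℂ, (∀ N, ∑ n ∈ Finset.range N, ‖A n‖ ^ 2 ≤ L) ∧
      ∀ z ∈ ball (0 : ℂ) 1, Filter.Tendsto (fun k => ∑' n, a k n * z ^ n)
        (Filter.hyperfilter ℕ : Filter ℕ) (nhds (∑' n, A n * z ^ n)) := by
  have h1 : ∀ n, ∃ A : ℂ, Filter.Tendsto (fun k => a k n) (Filter.hyperfilter ℕ : Filter ℕ)
      (nhds A) := by
    intro n
    have hc := isCompact_closedBall (0 : ℂ) (Real.sqrt L)
    obtain ⟨A, -, hA⟩ := hc.ultrafilter_le_nhds ((Filter.hyperfilter ℕ).map (fun k => a k n)) (by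
      rw [Filter.le_principal_iff]
      refine Filter.mem_map.2 (Filter.univ_mem' fun k => ?_)
      simpa using sq_bound (ha k) n)
    exact ⟨A, hA⟩
  choose A hA using h1
  refine ⟨A, fun N => ?_, fun z hz => ?_⟩
  · have : Filter.Tendsto (fun k => ∑ n ∈ Finset.range N, ‖a k n‖ ^ 2)
        (Filter.hyperfilter ℕ : Filter ℕ) (nhds (∑ n ∈ Finset.range N, ‖A n‖ ^ 2)) :=
      tendsto_finsetSum _ fun n _ => ((hA n).norm.pow 2)
    exact le_of_tendsto this (Filter.Eventually.of_forall fun k => ha k N)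
  · have hz : ‖z‖ < 1 := by simpa using hz
    apply tendsto_tsum_of_dominated_convergence (bound := fun n => Real.sqrt L * ‖z‖ ^ n)
    · exact (summable_geometric_of_lt_one (norm_nonneg _) hz).mul_left _
    · exact fun n => (hA n).mul_const _
    · refine Filter.Eventually.of_forall fun k n => ?_
      rw [norm_mul, norm_pow]
      gcongr
      exact sq_bound (ha k) n

/-- radii tending to one -/
noncomputable def rad (k : ℕ) : ℝ := 1 - 1 / ((k : ℝ) + 2)

lemma rad_mem (k : ℕ) : rad k ∈ Ioo (0 : ℝ) 1 := by
  have : (0 : ℝ) < (k : ℝ) + 2 := by positivity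
  constructor
  · unfold rad
    have : 1 / ((k : ℝ) + 2) < 1 := by
      rw [div_lt_one this]; linarith [Nat.cast_nonneg (α := ℝ) k]
    linarith
  · unfold rad
    have : 0 < 1 / ((k : ℝ) + 2) := by positivity
    linarith

lemma rad_tendsto : Filter.Tendsto rad Filter.atTop (nhdsWithin 1 (Iio 1)) := by
  apply tendsto_nhdsWithin_of_tendsto_nhds_of_eventually_within
  · have h := (tendsto_const_div_atTop_nhds_zero_nat (1 : ℝ)).comp (Filter.tendsto_add_atTop_nat 2)
    have h2 := h.const_sub 1
    rw [sub_zero] at h2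
    refine h2.congr fun k => ?_
    simp [rad]
  · exact Filter.Eventually.of_forall fun k => (rad_mem k).2

lemma h1_factor {h : ℂ → ℂ} (hh : DifferentiableOn ℂ h (ball 0 1)) {M : ℝ}
    (hM : ∀ r ∈ Ioo (0 : ℝ) 1, ∫ ζ, ‖h (r * ζ)‖ ∂circleMeasure ≤ M) :
    ∃ a b : ℕ → ℂ, (∀ N, ∑ n ∈ Finset.range N, ‖a n‖ ^ 2 ≤ M + 1) ∧
      (∀ N, ∑ n ∈ Finset.range N, ‖b n‖ ^ 2 ≤ M + 1) ∧
      ∀ z ∈ ball (0 : ℂ) 1, h z = (∑' n, a n * z ^ n) * (∑' n, b n * z ^ n) := by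
  have hp : ∀ k : ℕ, ∃ p : Polynomial ℂ, ∀ z : ℂ, ‖z‖ ≤ 1 →
      ‖p.eval z - h (rad k * z)‖ ≤ 1 / ((k : ℝ) + 1) := fun k =>
    approx_poly hh (rad_mem k).1.le (rad_mem k).2 (by positivity)
  choose p hp using hp
  have hpI : ∀ k, ∫ ζ, ‖(p k).eval ζ‖ ∂circleMeasure ≤ M + 1 := by
    intro k
    have hinteg : Integrable (fun ζ => ‖h (rad k * ζ)‖) circleMeasure :=
      (cm_integrable ((dilate_cont hh (rad_mem k).1.le (rad_mem k).2).mono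
        sphere_subset_closedBall)).norm
    calc ∫ ζ, ‖(p k).eval ζ‖ ∂circleMeasure ≤ ∫ ζ, (‖h (rad k * ζ)‖ + 1) ∂circleMeasure := by
          apply integral_mono_ae
          · exact (cm_integrable (F := fun ζ => (p k).eval ζ) (by fun_prop)).norm
          · exact hinteg.add (integrable_const _)
          · filter_upwards [cm_norm] with ζ hζ
            have h1 := hp k ζ hζ.le
            have h2 : 1 / ((k : ℝ) + 1) ≤ 1 := by
              rw [div_le_one (by positivity)]; linarith [Nat.cast_nonneg (α := ℝ) k]
            have h3 := norm_sub_norm_le ((p k).eval ζ) (h (rad k * ζ))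
            linarith
      _ = ∫ ζ, ‖h (rad k * ζ)‖ ∂circleMeasure + 1 := by
          rw [integral_add hinteg (integrable_const _)]; simp
      _ ≤ M + 1 := by linarith [hM _ (rad_mem k)]
  choose a b ha hb hab using fun k => poly_coeffs (p k)
  obtain ⟨A, hA, hA'⟩ := ultra_lim a (fun k N => (ha k N).trans (hpI k))
  obtain ⟨B, hB, hB'⟩ := ultra_lim b (fun k N => (hb k N).trans (hpI k))
  refine ⟨A, B, hA, hB, fun z hz => ?_⟩
  have t1 := (hA' z hz).mul (hB' z hz)
  simp_rw [← hab _ z hz] at t1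
  refine tendsto_nhds_unique ?_ t1
  have hz' : ‖z‖ < 1 := by simpa using hz
  have hle : (Filter.hyperfilter ℕ : Filter ℕ) ≤ Filter.atTop := Nat.hyperfilter_le_atTop
  apply Filter.Tendsto.mono_left _ hle
  have t2 : Filter.Tendsto (fun k => h (rad k * z)) Filter.atTop (nhds (h z)) := by
    have hc : ContinuousAt h z := (hh.differentiableAt (isOpen_ball.mem_nhds hz)).continuousAt
    apply hc.tendsto.comp
    have := (Complex.continuous_ofReal.tendsto 1).comp (rad_tendsto.mono_right nhdsWithin_le_nhds)
    simpa using this.mul_const z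
  have t3 : Filter.Tendsto (fun k => (p k).eval z - h (rad k * z)) Filter.atTop (nhds 0) := by
    apply squeeze_zero_norm (fun k => hp k z hz'.le)
    exact tendsto_one_div_add_atTop_nhds_zero_nat
  simpa using t3.add t2

lemma sq_summable {a : ℕ → ℂ} {L : ℝ} (ha : ∀ N, ∑ n ∈ Finset.range N, ‖a n‖ ^ 2 ≤ L) :
    Summable (fun n => ‖a n‖ ^ 2) :=
  summable_of_sum_range_le (fun _ => by positivity) ha

lemma sq_abs_summable {a : ℕ → ℂ} {L : ℝ} (ha : ∀ N, ∑ n ∈ Finset.range N, ‖a n‖ ^ 2 ≤ L)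
    {r : ℝ} (hr : r ∈ Ioo (0 : ℝ) 1) : Summable (fun n => ‖a n * (r : ℂ) ^ n‖) := by
  refine Summable.of_nonneg_of_le (fun _ => norm_nonneg _) (fun n => ?_)
    ((summable_geometric_of_lt_one hr.1.le hr.2).mul_left (Real.sqrt L))
  rw [norm_mul, norm_pow, Complex.norm_real, Real.norm_of_nonneg hr.1.le]
  have := hr.1
  gcongr
  exact sq_bound ha n

lemma ps_dil (a : ℕ → ℂ) (r : ℝ) (ζ : ℂ) :
    ∑' n, a n * ((r : ℂ) * ζ) ^ n = ∑' n, (a n * (r : ℂ) ^ n) * ζ ^ n := by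
  congr 1
  ext n
  rw [mul_pow, mul_assoc]

lemma l2_norm_le {a : ℕ → ℂ} {L : ℝ} (ha : ∀ N, ∑ n ∈ Finset.range N, ‖a n‖ ^ 2 ≤ L)
    {r : ℝ} (hr : r ∈ Ioo (0 : ℝ) 1) :
    ∫ ζ, ‖∑' n, a n * ((r : ℂ) * ζ) ^ n‖ ^ 2 ∂circleMeasure ≤ L := by
  simp_rw [ps_dil]
  have := cm_parseval_sq (sq_abs_summable ha hr)
  rw [← this.tsum_eq]
  refine le_trans (Summable.tsum_le_tsum (fun n => ?_) this.summable (sq_summable ha)) ?_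
  · rw [norm_mul, mul_pow]
    apply mul_le_of_le_one_right (by positivity)
    rw [norm_pow, Complex.norm_real, Real.norm_of_nonneg hr.1.le]
    exact pow_le_one₀ (pow_nonneg hr.1.le _) (pow_le_one₀ hr.1.le hr.2.le)
  · exact Real.tsum_le_of_sum_range_le (fun _ => by positivity) ha

lemma l2_cauchy {a : ℕ → ℂ} {L : ℝ} (ha : ∀ N, ∑ n ∈ Finset.range N, ‖a n‖ ^ 2 ≤ L)
    {ρ : ℝ} (hρ : 0 < ρ) : ∃ r₀ ∈ Ioo (0 : ℝ) 1, ∀ r ∈ Ioo r₀ 1, ∀ s ∈ Ioo r₀ 1,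
      ∫ ζ, ‖(∑' n, a n * ((r : ℂ) * ζ) ^ n) - ∑' n, a n * ((s : ℂ) * ζ) ^ n‖ ^ 2 ∂circleMeasure
        ≤ ρ := by
  have ht : Filter.Tendsto (fun k => ∑' n, ‖a n‖ ^ 2 * (1 - rad k ^ n) ^ 2) Filter.atTop
      (nhds (∑' n, ‖a n‖ ^ 2 * (1 - 1 ^ n) ^ 2)) := by
    apply tendsto_tsum_of_dominated_convergence (bound := fun n => ‖a n‖ ^ 2) (sq_summable ha)
    · intro n
      have := rad_tendsto.mono_right nhdsWithin_le_nhds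
      exact (((this.pow n).const_sub 1).pow 2).const_mul _
    · refine Filter.Eventually.of_forall fun k n => ?_
      have h1 : 0 ≤ rad k ^ n := pow_nonneg (rad_mem k).1.le _
      have h2 : rad k ^ n ≤ 1 := pow_le_one₀ (rad_mem k).1.le (rad_mem k).2.le
      rw [Real.norm_of_nonneg (by positivity)]
      apply mul_le_of_le_one_right (by positivity)
      apply pow_le_one₀ <;> linarith
  simp only [one_pow, sub_self, ne_eq, OfNat.ofNat_ne_zero, not_false_eq_true, zero_pow,
    mul_zero, tsum_zero] at ht
  obtain ⟨k, hk⟩ := (ht.eventually (gt_mem_nhds hρ)).exists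
  refine ⟨rad k, rad_mem k, fun r hr s hs => ?_⟩
  have hr' : r ∈ Ioo (0 : ℝ) 1 := ⟨(rad_mem k).1.trans hr.1, hr.2⟩
  have hs' : s ∈ Ioo (0 : ℝ) 1 := ⟨(rad_mem k).1.trans hs.1, hs.2⟩
  have S1 := sq_abs_summable ha hr'
  have S2 := sq_abs_summable ha hs'
  have S3 : Summable fun n => ‖a n * (r : ℂ) ^ n - a n * (s : ℂ) ^ n‖ :=
    Summable.of_nonneg_of_le (fun _ => norm_nonneg _) (fun n => norm_sub_le _ _) (S1.add S2)
  have hP := cm_parseval_sq S3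
  have e : ∫ ζ, ‖(∑' n, a n * ((r : ℂ) * ζ) ^ n) - ∑' n, a n * ((s : ℂ) * ζ) ^ n‖ ^ 2 ∂circleMeasure
      = ∫ ζ, ‖∑' n, (a n * (r : ℂ) ^ n - a n * (s : ℂ) ^ n) * ζ ^ n‖ ^ 2 ∂circleMeasure := by
    apply integral_congr_ae
    filter_upwards [cm_norm] with ζ hζ
    have q : ∀ c : ℕ → ℂ, Summable (fun n => ‖c n‖) → Summable fun n => c n * ζ ^ n := by
      intro c hc
      apply Summable.of_norm
      simpa [hζ] using hc
    simp_rw [ps_dil]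
    rw [← (q _ S1).tsum_sub (q _ S2)]
    simp_rw [sub_mul]
  rw [e, ← hP.tsum_eq]
  refine le_trans (Summable.tsum_le_tsum (fun n => ?_) hP.summable ?_) hk.le
  · rw [← mul_sub, norm_mul, mul_pow]
    gcongr
    rw [← Complex.ofReal_pow, ← Complex.ofReal_pow, ← Complex.ofReal_sub, Complex.norm_real,
      Real.norm_eq_abs, abs_le]
    have h1 : rad k ^ n ≤ r ^ n := pow_le_pow_left₀ (rad_mem k).1.le hr.1.le n
    have h2 : rad k ^ n ≤ s ^ n := pow_le_pow_left₀ (rad_mem k).1.le hs.1.le n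
    have h3 : r ^ n ≤ 1 := pow_le_one₀ hr'.1.le hr'.2.le
    have h4 : s ^ n ≤ 1 := pow_le_one₀ hs'.1.le hs'.2.le
    constructor <;> linarith
  · refine Summable.of_nonneg_of_le (fun _ => by positivity) (fun n => ?_) (sq_summable ha)
    have h1 : 0 ≤ rad k ^ n := pow_nonneg (rad_mem k).1.le _
    have h2 : rad k ^ n ≤ 1 := pow_le_one₀ (rad_mem k).1.le (rad_mem k).2.le
    apply mul_le_of_le_one_right (by positivity)
    apply pow_le_one₀ <;> linarith

lemma l2_cont {a : ℕ → ℂ} {L : ℝ} (ha : ∀ N, ∑ n ∈ Finset.range N, ‖a n‖ ^ 2 ≤ L)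
    {r : ℝ} (hr : r ∈ Ioo (0 : ℝ) 1) :
    ContinuousOn (fun ζ : ℂ => ∑' n, a n * ((r : ℂ) * ζ) ^ n) (sphere 0 1) := by
  simp_rw [ps_dil]
  exact (ps_cont (sq_abs_summable ha hr)).mono sphere_subset_closedBall

/-- AM-GM form of Cauchy-Schwarz -/
lemma int_mul_le {u v : ℂ → ℂ} (hu : ContinuousOn u (sphere 0 1)) (hv : ContinuousOn v (sphere 0 1))
    {t x y : ℝ} (ht : 0 < t) (hx : ∫ ζ, ‖u ζ‖ ^ 2 ∂circleMeasure ≤ x)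
    (hy : ∫ ζ, ‖v ζ‖ ^ 2 ∂circleMeasure ≤ y) :
    ∫ ζ, ‖u ζ * v ζ‖ ∂circleMeasure ≤ t⁻¹ * x + t * y := by
  have iu : Integrable (fun ζ => ‖u ζ‖ ^ 2) circleMeasure := by
    simpa using (cm_integrable (hu.pow 2)).norm
  have iv : Integrable (fun ζ => ‖v ζ‖ ^ 2) circleMeasure := by
    simpa using (cm_integrable (hv.pow 2)).norm
  calc ∫ ζ, ‖u ζ * v ζ‖ ∂circleMeasure
      ≤ ∫ ζ, (t⁻¹ * ‖u ζ‖ ^ 2 + t * ‖v ζ‖ ^ 2) ∂circleMeasure := by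
        apply integral_mono (cm_integrable (hu.mul hv)).norm ((iu.const_mul _).add (iv.const_mul _))
        intro ζ
        change ‖u ζ * v ζ‖ ≤ t⁻¹ * ‖u ζ‖ ^ 2 + t * ‖v ζ‖ ^ 2
        rw [norm_mul]
        have : 0 ≤ t⁻¹ * (‖u ζ‖ - t * ‖v ζ‖) ^ 2 := by positivity
        have e : t⁻¹ * (‖u ζ‖ - t * ‖v ζ‖) ^ 2 =
          t⁻¹ * ‖u ζ‖ ^ 2 + t * ‖v ζ‖ ^ 2 - 2 * (‖u ζ‖ * ‖v ζ‖) := by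
          field_simp
          ring
        nlinarith [mul_nonneg (norm_nonneg (u ζ)) (norm_nonneg (v ζ))]
    _ = t⁻¹ * ∫ ζ, ‖u ζ‖ ^ 2 ∂circleMeasure + t * ∫ ζ, ‖v ζ‖ ^ 2 ∂circleMeasure := by
        rw [integral_add (iu.const_mul _) (iv.const_mul _), integral_const_mul, integral_const_mul]
    _ ≤ _ := by gcongr

lemma h1_cauchy {h : ℂ → ℂ} (hh : DifferentiableOn ℂ h (ball 0 1)) {M : ℝ}
    (hM : ∀ r ∈ Ioo (0 : ℝ) 1, ∫ ζ, ‖h (r * ζ)‖ ∂circleMeasure ≤ M) {ρ : ℝ} (hρ : 0 < ρ) :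
    ∃ r₀ ∈ Ioo (0 : ℝ) 1, ∀ r ∈ Ioo r₀ 1, ∀ s ∈ Ioo r₀ 1,
      ∫ ζ, ‖h (r * ζ) - h (s * ζ)‖ ∂circleMeasure ≤ ρ := by
  obtain ⟨a, b, ha, hb, hab⟩ := h1_factor hh hM
  have hM0 : 0 ≤ M := (integral_nonneg fun ζ => norm_nonneg _).trans (hM _ (rad_mem 0))
  obtain ⟨t, ht, htL⟩ : ∃ t : ℝ, 0 < t ∧ t * (M + 1) = ρ / 4 :=
    ⟨ρ / 4 / (M + 1), by positivity, by field_simp⟩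
  obtain ⟨r1, hr1, H1⟩ := l2_cauchy ha (ρ := t * (ρ / 4)) (by positivity)
  obtain ⟨r2, hr2, H2⟩ := l2_cauchy hb (ρ := t * (ρ / 4)) (by positivity)
  refine ⟨max r1 r2, ⟨lt_max_of_lt_left hr1.1, max_lt hr1.2 hr2.2⟩, fun r hr s hs => ?_⟩
  have hr' : r ∈ Ioo (0 : ℝ) 1 := ⟨(lt_max_of_lt_left hr1.1).trans hr.1, hr.2⟩
  have hs' : s ∈ Ioo (0 : ℝ) 1 := ⟨(lt_max_of_lt_left hr1.1).trans hs.1, hs.2⟩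
  have q1 := H1 r ⟨(le_max_left _ _).trans_lt hr.1, hr.2⟩ s ⟨(le_max_left _ _).trans_lt hs.1, hs.2⟩
  have q2 := H2 r ⟨(le_max_right _ _).trans_lt hr.1, hr.2⟩ s ⟨(le_max_right _ _).trans_lt hs.1, hs.2⟩
  have c1 := int_mul_le ((l2_cont ha hr').sub (l2_cont ha hs')) (l2_cont hb hr') ht q1
    (l2_norm_le hb hr')
  have c2 := int_mul_le ((l2_cont hb hr').sub (l2_cont hb hs')) (l2_cont ha hs') ht q2
    (l2_norm_le ha hs')
  have e : t⁻¹ * (t * (ρ / 4)) + t * (M + 1) = ρ / 2 := by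
    rw [htL]; field_simp; ring
  rw [e] at c1 c2
  have i1 := (cm_integrable (((l2_cont ha hr').sub (l2_cont ha hs')).mul (l2_cont hb hr'))).norm
  have i2 := (cm_integrable (((l2_cont hb hr').sub (l2_cont hb hs')).mul (l2_cont ha hs'))).norm
  have fin : ∫ ζ, ‖h (r * ζ) - h (s * ζ)‖ ∂circleMeasure ≤ ρ / 2 + ρ / 2 := by
    refine le_trans ?_ ((integral_add i1 i2).le.trans (add_le_add c1 c2))
    apply integral_mono_of_nonneg (Filter.Eventually.of_forall fun _ => norm_nonneg _) (i1.add i2)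
    filter_upwards [cm_norm] with ζ hζ
    rw [hab (r * ζ) (by simp [hζ, abs_of_pos hr'.1, hr'.2]),
      hab (s * ζ) (by simp [hζ, abs_of_pos hs'.1, hs'.2])]
    refine le_trans (le_of_eq ?_) (norm_add_le _ _)
    congr 1
    simp only [Pi.sub_apply, Pi.mul_apply]
    ring
  linarith

lemma hardy_le {h : ℂ → ℂ} {r : ℝ} (hr : r ∈ Ioo (0 : ℝ) 1) :
    ∫⁻ ζ, ‖h (r * ζ)‖ₑ ∂circleMeasure ≤ hardyNorm 1 h := by
  unfold hardyNorm
  refine le_trans (le_of_eq ?_) (le_iSup₂ (f := fun (r : ℝ) (_ : r ∈ Ioo (0 : ℝ) 1) =>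
    ∫⁻ ζ, ENNReal.ofReal (‖h (↑r * ζ)‖ ^ (1 : ℝ)) ∂circleMeasure) r hr)
  simp

lemma hardy_means {h : ℂ → ℂ} (hh : DifferentiableOn ℂ h (ball 0 1)) (hn : hardyNorm 1 h ≠ ⊤) :
    ∀ r ∈ Ioo (0 : ℝ) 1, ∫ ζ, ‖h (r * ζ)‖ ∂circleMeasure ≤ (hardyNorm 1 h).toReal := by
  intro r hr
  have hc := (dilate_cont hh hr.1.le hr.2).mono sphere_subset_closedBall
  rw [integral_norm_eq_lintegral_enorm (cm_aesm hc)]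
  exact ENNReal.toReal_mono hn (hardy_le hr)

lemma bdry_seq {h hs : ℂ → ℂ} (hb : IsBoundaryFn h hs) :
    ∀ᵐ ζ ∂circleMeasure, Filter.Tendsto (fun k => h (rad k * ζ)) Filter.atTop (nhds (hs ζ)) := by
  filter_upwards [hb] with ζ hζ using hζ.comp rad_tendsto

lemma dil_aesm {h : ℂ → ℂ} (hh : DifferentiableOn ℂ h (ball 0 1)) {r : ℝ} (hr : r ∈ Ioo (0 : ℝ) 1) :
    AEStronglyMeasurable (fun ζ => h (r * ζ)) circleMeasure :=
  cm_aesm ((dilate_cont hh hr.1.le hr.2).mono sphere_subset_closedBall)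

lemma bdry_aesm {h hs : ℂ → ℂ} (hh : DifferentiableOn ℂ h (ball 0 1)) (hb : IsBoundaryFn h hs) :
    AEStronglyMeasurable hs circleMeasure :=
  aestronglyMeasurable_of_tendsto_ae Filter.atTop (fun k => dil_aesm hh (rad_mem k)) (bdry_seq hb)

lemma bdry_fatou {h hs : ℂ → ℂ} (hh : DifferentiableOn ℂ h (ball 0 1)) (hb : IsBoundaryFn h hs) :
    ∫⁻ ζ, ‖hs ζ‖ₑ ∂circleMeasure ≤ hardyNorm 1 h := by
  calc ∫⁻ ζ, ‖hs ζ‖ₑ ∂circleMeasure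
      = ∫⁻ ζ, Filter.liminf (fun k => ‖h (rad k * ζ)‖ₑ) Filter.atTop ∂circleMeasure := by
        apply lintegral_congr_ae
        filter_upwards [bdry_seq hb] with ζ hζ using hζ.enorm.liminf_eq.symm
    _ ≤ Filter.liminf (fun k => ∫⁻ ζ, ‖h (rad k * ζ)‖ₑ ∂circleMeasure) Filter.atTop :=
        lintegral_liminf_le' fun k => (dil_aesm hh (rad_mem k)).enorm
    _ ≤ hardyNorm 1 h := by
        apply Filter.liminf_le_of_le (by isBoundedDefault)
        intro b hb
        obtain ⟨k, hk⟩ := hb.exists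
        exact hk.trans (hardy_le (rad_mem k))

lemma bdry_integrable {h hs : ℂ → ℂ} (hh : DifferentiableOn ℂ h (ball 0 1))
    (hn : hardyNorm 1 h ≠ ⊤) (hb : IsBoundaryFn h hs) : Integrable hs circleMeasure :=
  ⟨bdry_aesm hh hb, (bdry_fatou hh hb).trans_lt (lt_top_iff_ne_top.2 hn)⟩

lemma l1_close {h hs : ℂ → ℂ} (hh : DifferentiableOn ℂ h (ball 0 1))
    (hn : hardyNorm 1 h ≠ ⊤) (hb : IsBoundaryFn h hs) {ρ : ℝ} (hρ : 0 < ρ) :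
    ∃ r₀ ∈ Ioo (0 : ℝ) 1, ∀ r ∈ Ioo r₀ 1, ∫ ζ, ‖h (r * ζ) - hs ζ‖ ∂circleMeasure ≤ ρ := by
  obtain ⟨r₀, hr₀, H⟩ := h1_cauchy hh (hardy_means hh hn) hρ
  refine ⟨r₀, hr₀, fun r hr => ?_⟩
  have hr' : r ∈ Ioo (0 : ℝ) 1 := ⟨hr₀.1.trans hr.1, hr.2⟩
  rw [integral_norm_eq_lintegral_enorm (f := fun ζ => h (r * ζ) - hs ζ)
    ((dil_aesm hh hr').sub (bdry_aesm hh hb))]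
  apply ENNReal.toReal_le_of_le_ofReal hρ.le
  calc ∫⁻ ζ, ‖h (r * ζ) - hs ζ‖ₑ ∂circleMeasure
      = ∫⁻ ζ, Filter.liminf (fun k => ‖h (r * ζ) - h (rad k * ζ)‖ₑ) Filter.atTop ∂circleMeasure := by
        apply lintegral_congr_ae
        filter_upwards [bdry_seq hb] with ζ hζ using (hζ.const_sub _).enorm.liminf_eq.symm
    _ ≤ Filter.liminf (fun k => ∫⁻ ζ, ‖h (r * ζ) - h (rad k * ζ)‖ₑ ∂circleMeasure) Filter.atTop :=
        lintegral_liminf_le' fun k => ((dil_aesm hh hr').sub (dil_aesm hh (rad_mem k))).enorm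
    _ ≤ ENNReal.ofReal ρ := by
        apply Filter.liminf_le_of_le (by isBoundedDefault)
        intro b hb
        have hev : ∀ᶠ k in Filter.atTop, rad k ∈ Ioo r₀ 1 := rad_tendsto (Ioo_mem_nhdsLT hr₀.2)
        obtain ⟨k, hk, hk2⟩ := (hb.and hev).exists
        refine hk.trans ?_
        have i : Integrable (fun ζ => h (r * ζ) - h (rad k * ζ)) circleMeasure :=
          cm_integrable (((dilate_cont hh hr'.1.le hr'.2).sub
            (dilate_cont hh (rad_mem k).1.le (rad_mem k).2)).mono sphere_subset_closedBall)
        rw [← ofReal_integral_norm_eq_lintegral_enorm i]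
        exact ENNReal.ofReal_le_ofReal (H r hr _ hk2)

lemma kern_cont {z : ℂ} (hz : z ∈ ball (0 : ℂ) 1) :
    ContinuousOn (fun ζ => (1 - (starRingEnd ℂ) ζ * z)⁻¹) (sphere (0 : ℂ) 1) := by
  apply ContinuousOn.inv₀ (by fun_prop)
  intro ζ hζ h0
  have hz' : ‖z‖ < 1 := by simpa using hz
  have hζ' : ‖ζ‖ = 1 := by simpa using hζ
  have : (starRingEnd ℂ) ζ * z = 1 := by linear_combination -h0
  have := congrArg norm this
  simp [hζ'] at this
  linarith

lemma cauchy_dil {h : ℂ → ℂ} (hh : DifferentiableOn ℂ h (ball 0 1)) {z : ℂ}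
    (hz : z ∈ ball (0 : ℂ) 1) {r : ℝ} (hr : r ∈ Ioo (0 : ℝ) 1) :
    ∫ ζ, h (r * ζ) * (1 - (starRingEnd ℂ) ζ * z)⁻¹ ∂circleMeasure = h (r * z) := by
  have hz' : ‖z‖ < 1 := by simpa using hz
  have hd : Summable fun n : ℕ => ‖((starRingEnd ℂ) z) ^ n‖ := by
    simpa using summable_geometric_of_lt_one (norm_nonneg _) hz'
  have := (cm_parseval (taylor_summable hh hr.1.le hr.2) hd).tsum_eq
  rw [taylor_dilate hh hr.1.le hr.2 hz'.le]
  simp only [map_pow, Complex.conj_conj] at this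
  rw [this]
  apply integral_congr_ae
  filter_upwards [cm_norm] with ζ hζ
  rw [taylor_dilate hh hr.1.le hr.2 hζ.le]
  congr 1
  simp_rw [← mul_pow]
  rw [tsum_geometric_of_norm_lt_one (by simpa [hζ] using hz')]
  simp [mul_comm]

lemma cauchy_formula {h hs : ℂ → ℂ} (hh : DifferentiableOn ℂ h (ball 0 1))
    (hn : hardyNorm 1 h ≠ ⊤) (hb : IsBoundaryFn h hs) {z : ℂ} (hz : z ∈ ball (0 : ℂ) 1) :
    ∫ ζ, hs ζ * (1 - (starRingEnd ℂ) ζ * z)⁻¹ ∂circleMeasure = h z := by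
  obtain ⟨C, hC⟩ := (isCompact_sphere (0 : ℂ) 1).exists_bound_of_continuousOn (kern_cont hz)
  have hC0 : 0 ≤ C := (norm_nonneg _).trans (hC 1 (by simp))
  have ihs := bdry_integrable hh hn hb
  have hCae : ∀ᵐ ζ ∂circleMeasure, ‖(1 - (starRingEnd ℂ) ζ * z)⁻¹‖ ≤ C := by
    filter_upwards [cm_norm] with ζ hζ using hC ζ (by simpa using hζ)
  have t1 : Filter.Tendsto (fun r : ℝ => h (r * z)) (nhdsWithin 1 (Iio 1)) (nhds (h z)) := by
    have hc : ContinuousAt h z := (hh.differentiableAt (isOpen_ball.mem_nhds hz)).continuousAt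
    apply hc.tendsto.comp
    have : Filter.Tendsto (fun r : ℝ => (r : ℂ) * z) (nhds 1) (nhds (((1 : ℝ) : ℂ) * z)) :=
      Continuous.tendsto (by fun_prop) 1
    simpa using this.mono_left nhdsWithin_le_nhds
  refine tendsto_nhds_unique ?_ t1
  rw [Metric.tendsto_nhds]
  intro η hη
  obtain ⟨r₀, hr₀, H⟩ := l1_close hh hn hb (ρ := η / (2 * (C + 1))) (by positivity)
  filter_upwards [Ioo_mem_nhdsLT hr₀.2] with r hr
  have hr' : r ∈ Ioo (0 : ℝ) 1 := ⟨hr₀.1.trans hr.1, hr.2⟩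
  have id : Integrable (fun ζ => h (r * ζ)) circleMeasure :=
    cm_integrable ((dilate_cont hh hr'.1.le hr'.2).mono sphere_subset_closedBall)
  have km := cm_aesm (kern_cont hz)
  rw [← cauchy_dil hh hz hr', dist_eq_norm, ← integral_sub (id.mul_bdd (c := C) km hCae)
    (ihs.mul_bdd (c := C) km hCae)]
  calc _ ≤ ∫ ζ, ‖h (r * ζ) - hs ζ‖ * C ∂circleMeasure := by
        apply norm_integral_le_of_norm_le
        · exact (id.sub ihs).norm.mul_const C
        · filter_upwards [hCae] with ζ hζ
          rw [← sub_mul, norm_mul]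
          gcongr
    _ = (∫ ζ, ‖h (r * ζ) - hs ζ‖ ∂circleMeasure) * C := integral_mul_const _ _
    _ ≤ η / (2 * (C + 1)) * C := by gcongr; exact H r hr
    _ < η := by
      rw [div_mul_eq_mul_div, div_lt_iff₀ (by positivity)]
      nlinarith

/-- the weight -/
noncomputable def wt (ε s : ℝ) : ℝ := Real.exp (-s) * s ^ (ε - 1)

lemma wt_int {ε : ℝ} (hε : 0 < ε) : IntegrableOn (wt ε) (Ioi 0) :=
  Real.GammaIntegral_convergent hε

lemma wt_eq {ε : ℝ} (hε : 0 < ε) : ∫ s in Ioi (0 : ℝ), wt ε s = Real.Gamma ε :=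
  (Real.Gamma_eq_integral hε).symm

lemma wt_nonneg {ε s : ℝ} (hs : s ∈ Ioi (0 : ℝ)) : 0 ≤ wt ε s := by
  have : (0 : ℝ) < s := hs
  unfold wt; positivity

lemma exp_mem {s : ℝ} (hs : s ∈ Ioi (0 : ℝ)) {z : ℂ} (hz : ‖z‖ ≤ 1) :
    (Real.exp (-s) : ℂ) * z ∈ ball (0 : ℂ) 1 := by
  have h1 : Real.exp (-s) < 1 := by
    rw [Real.exp_lt_one_iff]; have : (0 : ℝ) < s := hs; linarith
  have h0 := Real.exp_pos (-s)
  rw [mem_ball_zero_iff, norm_mul, Complex.norm_real, Real.norm_of_nonneg h0.le]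
  nlinarith [norm_nonneg z]

/-- extension of `f * α` to the closed disk -/
noncomputable def Gf (ε : ℝ) (f : ℂ → ℂ) (z : ℂ) : ℂ :=
  (Real.Gamma ε : ℂ)⁻¹ * ∫ s in Ioi (0 : ℝ), (wt ε s : ℂ) * f ((Real.exp (-s) : ℂ) * z)

lemma Gf_int {ε : ℝ} (hε : 0 < ε) {f : ℂ → ℂ} (hf : DifferentiableOn ℂ f (ball 0 1)) {M : ℝ}
    (hM : ∀ z ∈ ball (0 : ℂ) 1, ‖f z‖ ≤ M) {z : ℂ} (hz : ‖z‖ ≤ 1) :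
    IntegrableOn (fun s : ℝ => (wt ε s : ℂ) * f ((Real.exp (-s) : ℂ) * z)) (Ioi 0) := by
  apply Integrable.mul_bdd (c := M) (wt_int hε).ofReal
  · apply ContinuousOn.aestronglyMeasurable _ measurableSet_Ioi
    apply hf.continuousOn.comp (by fun_prop)
    exact fun s hs => exp_mem hs hz
  · filter_upwards [ae_restrict_mem measurableSet_Ioi] with s hs using hM _ (exp_mem hs hz)

lemma Gf_bound {ε : ℝ} (hε : 0 < ε) {f : ℂ → ℂ} {M : ℝ}
    (hM : ∀ z ∈ ball (0 : ℂ) 1, ‖f z‖ ≤ M) {z : ℂ} (hz : ‖z‖ ≤ 1) : ‖Gf ε f z‖ ≤ M := by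
  have hG := Real.Gamma_pos_of_pos hε
  unfold Gf
  rw [norm_mul, norm_inv, Complex.norm_real, Real.norm_of_nonneg hG.le, inv_mul_le_iff₀ hG,
    ← wt_eq hε, ← integral_mul_const]
  apply norm_integral_le_of_norm_le ((wt_int hε).mul_const M)
  filter_upwards [ae_restrict_mem measurableSet_Ioi] with s hs
  rw [norm_mul, Complex.norm_real, Real.norm_of_nonneg (wt_nonneg hs)]
  exact mul_le_mul_of_nonneg_left (hM _ (exp_mem hs hz)) (wt_nonneg hs)

lemma f_lip {f : ℂ → ℂ} (hf : DifferentiableOn ℂ f (ball 0 1)) {M : ℝ}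
    (hM : ∀ z ∈ ball (0 : ℂ) 1, ‖f z‖ ≤ M) {ρ : ℝ} (hρ : ρ < 1) {a b : ℂ}
    (ha : ‖a‖ ≤ ρ) (hb : ‖b‖ ≤ ρ) : ‖f a - f b‖ ≤ (2 * M + 1) * (‖a - b‖ / (1 - ρ)) := by
  have hM0 : 0 ≤ M := (norm_nonneg _).trans (hM 0 (by simp))
  have ha' : a ∈ ball (0 : ℂ) 1 := by simpa using ha.trans_lt hρ
  have hb' : b ∈ ball (0 : ℂ) 1 := by simpa using hb.trans_lt hρ
  have h1 : 0 < 1 - ρ := by linarith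
  have hsub : ball b (1 - ρ) ⊆ ball (0 : ℂ) 1 := by
    apply ball_subset_ball'
    rw [dist_zero_right]; linarith
  have htriv : ∀ x ∈ ball (0 : ℂ) 1, ‖f x - f b‖ < 2 * M + 1 := fun x hx => by
    have := norm_sub_le (f x) (f b)
    have := hM x hx
    have := hM b hb'
    linarith
  by_cases hab : a ∈ ball b (1 - ρ)
  · have := Complex.dist_le_div_mul_dist_of_mapsTo_ball (hf.mono hsub)
      (R₂ := 2 * M + 1) (fun x hx => by
        have := htriv x (hsub hx)
        simpa [dist_eq_norm] using this.le) hab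
    rw [dist_eq_norm, dist_eq_norm] at this
    refine this.trans (le_of_eq ?_)
    ring
  · have h2 : 1 - ρ ≤ ‖a - b‖ := by simpa [dist_eq_norm] using hab
    refine (htriv a ha').le.trans ?_
    have : 1 ≤ ‖a - b‖ / (1 - ρ) := by rwa [one_le_div h1]
    nlinarith

lemma f_holder {f : ℂ → ℂ} (hf : DifferentiableOn ℂ f (ball 0 1)) {M : ℝ}
    (hM : ∀ z ∈ ball (0 : ℂ) 1, ‖f z‖ ≤ M) {δ : ℝ} (hδ0 : 0 < δ) (hδ1 : δ ≤ 1) {z w : ℂ}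
    (hz : ‖z‖ ≤ 1) (hw : ‖w‖ ≤ 1) {s : ℝ} (hs : s ∈ Ioi (0 : ℝ)) :
    ‖f ((Real.exp (-s) : ℂ) * z) - f ((Real.exp (-s) : ℂ) * w)‖ ≤
      (2 * M + 1) * (‖z - w‖ ^ δ * s ^ (-δ)) := by
  have hs0 : (0 : ℝ) < s := hs
  have hM0 : 0 ≤ M := (norm_nonneg _).trans (hM 0 (by simp))
  have he := Real.exp_pos (-s)
  have he1 : Real.exp (-s) < 1 := by rw [Real.exp_lt_one_iff]; linarith
  have hn : ∀ z : ℂ, ‖(Real.exp (-s) : ℂ) * z‖ = Real.exp (-s) * ‖z‖ := fun z => by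
    rw [norm_mul, Complex.norm_real, Real.norm_of_nonneg he.le]
  have h1 := f_lip hf hM he1 (a := (Real.exp (-s) : ℂ) * z) (b := (Real.exp (-s) : ℂ) * w)
    (by rw [hn]; nlinarith) (by rw [hn]; nlinarith)
  rw [← mul_sub, hn] at h1
  have h2 : Real.exp (-s) * ‖z - w‖ / (1 - Real.exp (-s)) ≤ ‖z - w‖ / s := by
    rw [div_le_div_iff₀ (by linarith) hs0]
    have h3 : Real.exp (-s) * s ≤ 1 - Real.exp (-s) := by
      have h4 := Real.add_one_le_exp s
      have h5 : Real.exp (-s) * Real.exp s = 1 := by rw [← Real.exp_add]; simp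
      nlinarith
    nlinarith [norm_nonneg (z - w)]
  have h3 : ‖z - w‖ ^ δ * s ^ (-δ) = (‖z - w‖ / s) ^ δ := by
    rw [Real.div_rpow (norm_nonneg _) hs0.le, Real.rpow_neg hs0.le]; rfl
  rw [h3]
  set t := ‖z - w‖ / s with ht
  have ht0 : 0 ≤ t := by positivity
  rcases le_total t 1 with h | h
  · refine h1.trans ?_
    gcongr
    refine h2.trans ?_
    have := Real.rpow_le_rpow_of_exponent_ge' ht0 h hδ0.le hδ1
    simpa using this
  · have := Real.one_le_rpow h hδ0.le
    have q1 := norm_sub_le (f ((Real.exp (-s) : ℂ) * z)) (f ((Real.exp (-s) : ℂ) * w))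
    have q2 := hM _ (exp_mem hs hz)
    have q3 := hM _ (exp_mem hs hw)
    nlinarith

lemma Gf_holder {ε : ℝ} {f : ℂ → ℂ} (hf : DifferentiableOn ℂ f (ball 0 1)) {M : ℝ}
    (hM : ∀ z ∈ ball (0 : ℂ) 1, ‖f z‖ ≤ M) {δ : ℝ} (hδ0 : 0 < δ) (hδ1 : δ ≤ 1) (hδε : δ < ε) :
    ∃ K : ℝ, 0 ≤ K ∧ ∀ z w : ℂ, ‖z‖ ≤ 1 → ‖w‖ ≤ 1 → ‖Gf ε f z - Gf ε f w‖ ≤ K * ‖z - w‖ ^ δ := by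
  have hε : 0 < ε := hδ0.trans hδε
  have hεδ : 0 < ε - δ := by linarith
  have hM0 : 0 ≤ M := (norm_nonneg _).trans (hM 0 (by simp))
  have hG := Real.Gamma_pos_of_pos hε
  have hG' := Real.Gamma_pos_of_pos hεδ
  refine ⟨(Real.Gamma ε)⁻¹ * ((2 * M + 1) * Real.Gamma (ε - δ)), by positivity,
    fun z w hz hw => ?_⟩
  unfold Gf
  rw [← mul_sub, norm_mul, norm_inv, Complex.norm_real, Real.norm_of_nonneg hG.le, mul_assoc,
    ← integral_sub (Gf_int hε hf hM hz) (Gf_int hε hf hM hw)]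
  apply mul_le_mul_of_nonneg_left _ (by positivity)
  have e : (2 * M + 1) * Real.Gamma (ε - δ) * ‖z - w‖ ^ δ =
      ∫ s in Ioi (0 : ℝ), ((2 * M + 1) * ‖z - w‖ ^ δ) * wt (ε - δ) s := by
    rw [integral_const_mul, wt_eq hεδ]; ring
  rw [e]
  apply norm_integral_le_of_norm_le ((wt_int hεδ).const_mul _)
  filter_upwards [ae_restrict_mem measurableSet_Ioi] with s hs
  have hs0 : (0 : ℝ) < s := hs
  rw [← mul_sub, norm_mul, Complex.norm_real, Real.norm_of_nonneg (wt_nonneg hs)]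
  have e2 : wt (ε - δ) s = wt ε s * s ^ (-δ) := by
    unfold wt
    rw [mul_assoc, ← Real.rpow_add hs0]
    congr 2; ring
  rw [e2]
  calc _ ≤ wt ε s * ((2 * M + 1) * (‖z - w‖ ^ δ * s ^ (-δ))) :=
        mul_le_mul_of_nonneg_left (f_holder hf hM hδ0 hδ1 hz hw hs) (wt_nonneg hs)
    _ = _ := by ring

lemma wt_moment {ε : ℝ} (hε : 0 < ε) (n : ℕ) :
    ∫ s in Ioi (0 : ℝ), wt ε s * Real.exp (-s) ^ n = Real.Gamma ε * (1 / ((n : ℝ) + 1) ^ ε) := by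
  have hn : (0 : ℝ) < (n : ℝ) + 1 := by positivity
  have := Real.integral_rpow_mul_exp_neg_mul_Ioi hε hn
  rw [Real.div_rpow zero_le_one hn.le, Real.one_rpow] at this
  rw [mul_comm, ← this]
  congr 1
  ext s
  unfold wt
  rw [← Real.exp_nat_mul, mul_comm (Real.exp (-s)), mul_assoc, ← Real.exp_add]
  congr 2
  ring

lemma seqConv_eq_Gf {ε : ℝ} (hε : 0 < ε) {f : ℂ → ℂ} (hf : DifferentiableOn ℂ f (ball 0 1))
    {z : ℂ} (hz : z ∈ ball (0 : ℂ) 1) :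
    seqConv f (fun n : ℕ => 1 / ((n : ℝ) + 1) ^ ε) z = Gf ε f z := by
  have hG := Real.Gamma_pos_of_pos hε
  have hz' : ‖z‖ < 1 := by simpa using hz
  have hi : ∀ n : ℕ, IntegrableOn (fun s => wt ε s * Real.exp (-s) ^ n) (Ioi 0) := by
    intro n
    apply Integrable.mul_bdd (c := 1) (wt_int hε) (by fun_prop)
    filter_upwards [ae_restrict_mem measurableSet_Ioi] with s hs
    have hs0 : (0 : ℝ) < s := hs
    rw [Real.norm_of_nonneg (by positivity)]
    exact pow_le_one₀ (Real.exp_pos _).le (Real.exp_le_one_iff.2 (by linarith))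
  have H := hasSum_integral_of_summable_integral_norm (μ := volume.restrict (Ioi (0 : ℝ)))
    (F := fun n (s : ℝ) => taylorCoeff f n * z ^ n * ((wt ε s * Real.exp (-s) ^ n : ℝ) : ℂ))
    (fun n => (hi n).ofReal.const_mul _) ?_
  · have e1 : ∀ n : ℕ, ∫ s in Ioi (0 : ℝ), taylorCoeff f n * z ^ n *
        ((wt ε s * Real.exp (-s) ^ n : ℝ) : ℂ) =
        taylorCoeff f n * z ^ n * ((Real.Gamma ε * (1 / ((n : ℝ) + 1) ^ ε) : ℝ) : ℂ) := by
      intro n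
      rw [integral_const_mul, integral_complex_ofReal, wt_moment hε]
    have e2 : ∫ s in Ioi (0 : ℝ), ∑' n, taylorCoeff f n * z ^ n *
        ((wt ε s * Real.exp (-s) ^ n : ℝ) : ℂ) =
        ∫ s in Ioi (0 : ℝ), (wt ε s : ℂ) * f ((Real.exp (-s) : ℂ) * z) := by
      apply setIntegral_congr_fun measurableSet_Ioi
      intro s hs
      simp only
      rw [← (taylor_hasSum hf (exp_mem hs hz'.le)).tsum_eq, ← tsum_mul_left]
      congr 1
      ext n
      push_cast
      rw [mul_pow]
      ring
    have H2 := H.tsum_eq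
    rw [e2] at H2
    unfold Gf
    rw [← H2, ← tsum_mul_left]
    unfold seqConv
    congr 1
    ext n
    rw [e1]
    have : (Real.Gamma ε : ℂ) ≠ 0 := by exact_mod_cast hG.ne'
    push_cast
    field_simp
  · refine Summable.of_nonneg_of_le (fun n => integral_nonneg fun ζ => norm_nonneg _) (fun n => ?_)
      ((taylor_hasSum hf hz).summable.norm.mul_right (Real.Gamma ε))
    have : ∫ s in Ioi (0 : ℝ), ‖taylorCoeff f n * z ^ n * ((wt ε s * Real.exp (-s) ^ n : ℝ) : ℂ)‖ =
        ∫ s in Ioi (0 : ℝ), ‖taylorCoeff f n * z ^ n‖ * (wt ε s * Real.exp (-s) ^ n) := by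
      apply setIntegral_congr_fun measurableSet_Ioi
      intro s hs
      simp only
      rw [norm_mul, Complex.norm_real, Real.norm_of_nonneg
        (mul_nonneg (wt_nonneg hs) (by positivity))]
    rw [this, integral_const_mul, wt_moment hε]
    gcongr
    apply mul_le_of_le_one_right hG.le
    rw [div_le_one (by positivity)]
    exact Real.one_le_rpow (by linarith [Nat.cast_nonneg (α := ℝ) n]) hε.le

lemma seqConv_diff {ε : ℝ} (hε : 0 < ε) {f : ℂ → ℂ} (hf : DifferentiableOn ℂ f (ball 0 1)) :
    DifferentiableOn ℂ (seqConv f (fun n : ℕ => 1 / ((n : ℝ) + 1) ^ ε)) (ball 0 1) := by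
  intro z hz
  have hz' : ‖z‖ < 1 := by simpa using hz
  set r : ℝ := (1 + ‖z‖) / 2 with hr
  have hr0 : 0 ≤ r := by positivity
  have hr1 : r < 1 := by rw [hr]; linarith
  apply DifferentiableAt.differentiableWithinAt
  have : DifferentiableOn ℂ (fun z => ∑' n : ℕ, taylorCoeff f n *
      ((1 / ((n : ℝ) + 1) ^ ε : ℝ) : ℂ) * z ^ n) (ball 0 r) := by
    apply Complex.differentiableOn_tsum_of_summable_norm (taylor_summable hf hr0 hr1)
    · intro n; fun_prop
    · exact isOpen_ball
    · intro n w hw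
      have hw' : ‖w‖ < r := by simpa using hw
      rw [norm_mul, norm_mul, norm_mul, norm_pow, norm_pow, Complex.norm_real, Complex.norm_real,
        Real.norm_of_nonneg hr0, Real.norm_of_nonneg (by positivity)]
      gcongr
      apply mul_le_of_le_one_right (norm_nonneg _)
      rw [div_le_one (by positivity)]
      exact Real.one_le_rpow (by linarith [Nat.cast_nonneg (α := ℝ) n]) hε.le
  exact this.differentiableAt (isOpen_ball.mem_nhds (by
    rw [mem_ball_zero_iff, hr]; linarith))

lemma chord_lower {u c : ℝ} (hc : c = 0 ∨ c = 2 * Real.pi) (hu : |u - c| ≤ Real.pi) :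
    2 / Real.pi * |u - c| ≤ ‖Complex.exp (Complex.I * u) - 1‖ := by
  have e : Complex.exp (Complex.I * u) = Complex.exp (Complex.I * ((u - c : ℝ) : ℂ)) := by
    rcases hc with rfl | rfl
    · simp
    · rw [Complex.exp_eq_exp_iff_exists_int]
      exact ⟨1, by push_cast; ring⟩
  rw [e, Complex.norm_exp_I_mul_ofReal_sub_one, norm_mul, Real.norm_eq_abs, Real.norm_eq_abs]
  have h := Real.mul_abs_le_abs_sin (x := (u - c) / 2) (by
    rw [abs_div, abs_two]; linarith)
  rw [abs_div, abs_two] at h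
  rw [abs_two]
  calc 2 / Real.pi * |u - c| = 2 * (2 / Real.pi * (|u - c| / 2)) := by ring
    _ ≤ _ := by gcongr

/-- one-dimensional majorant of the kernel -/
noncomputable def ker1 (δ t : ℝ) : ℝ≥0∞ := ENNReal.ofReal ((2 / Real.pi * |t|) ^ (δ - 1))

lemma ker1_meas (δ : ℝ) : Measurable (ker1 δ) := by
  unfold ker1; fun_prop

lemma ker1_fin {δ : ℝ} (hδ : 0 < δ) :
    ∫⁻ t in Icc (-(4 * Real.pi)) (4 * Real.pi), ker1 δ t ≠ ⊤ := by
  have hpi := Real.pi_pos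
  have h1 : IntervalIntegrable (fun t : ℝ => (2 / Real.pi * |t|) ^ (δ - 1)) volume 0 (4 * Real.pi) := by
    have h0 : IntervalIntegrable (fun t : ℝ => (2 / Real.pi) ^ (δ - 1) * t ^ (δ - 1)) volume 0
        (4 * Real.pi) :=
      (intervalIntegral.intervalIntegrable_rpow' (by linarith)).const_mul _
    apply h0.congr
    intro t ht
    rw [uIoc_of_le (by positivity)] at ht
    simp only
    rw [abs_of_pos ht.1, Real.mul_rpow (by positivity) ht.1.le]
  have h2 : IntervalIntegrable (fun t : ℝ => (2 / Real.pi * |t|) ^ (δ - 1)) volume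
      (-(4 * Real.pi)) 0 := by
    have := h1.symm.comp_sub_left 0
    simpa using this
  have h3 := h2.trans h1
  rw [intervalIntegrable_iff_integrableOn_Icc_of_le (by linarith)] at h3
  exact h3.lintegral_lt_top.ne

lemma ker1_shift {δ c : ℝ} (hc : c ∈ Icc (-Real.pi) (3 * Real.pi)) :
    ∫⁻ θ in Ioc 0 (2 * Real.pi), ker1 δ (θ - c) ≤
      ∫⁻ t in Icc (-(4 * Real.pi)) (4 * Real.pi), ker1 δ t := by
  have hpi := Real.pi_pos
  rw [← lintegral_indicator measurableSet_Ioc, ← lintegral_indicator measurableSet_Icc,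
    ← lintegral_sub_right_eq_self
      (fun t => (Icc (-(4 * Real.pi)) (4 * Real.pi)).indicator (ker1 δ) t) c]
  apply lintegral_mono
  intro θ
  by_cases h : θ ∈ Ioc 0 (2 * Real.pi)
  · have h' : θ - c ∈ Icc (-(4 * Real.pi)) (4 * Real.pi) := by
      constructor <;> linarith [h.1, h.2, hc.1, hc.2]
    simp only [indicator_of_mem h, indicator_of_mem h']
    exact le_rfl
  · simp only [indicator_of_notMem h]
    exact zero_le

lemma kern_bound {δ : ℝ} (hδ : 0 < δ) (hδ1 : δ < 1) : ∃ K : ℝ≥0∞, K ≠ ⊤ ∧ ∀ η : ℂ, ‖η‖ = 1 →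
    ∫⁻ ζ, ENNReal.ofReal (‖ζ - η‖ ^ (δ - 1)) ∂circleMeasure ≤ K := by
  have hpi := Real.pi_pos
  set J := ∫⁻ t in Icc (-(4 * Real.pi)) (4 * Real.pi), ker1 δ t with hJ
  have hJfin : J ≠ ⊤ := ker1_fin hδ
  refine ⟨(ENNReal.ofReal (2 * Real.pi))⁻¹ * (J + J), ?_, fun η hη => ?_⟩
  · apply ENNReal.mul_ne_top
    · simp [hpi]
    · simp [hJfin]
  · rw [cm_lintegral (by fun_prop)]
    gcongr
    set φ := Complex.arg η with hφ
    have hηφ : η = Complex.exp (φ * Complex.I) := by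
      have := Complex.norm_mul_exp_arg_mul_I η
      rw [hη] at this
      simpa using this.symm
    have hφ1 := Complex.neg_pi_lt_arg η
    have hφ2 := Complex.arg_le_pi η
    calc ∫⁻ θ in Ioc 0 (2 * Real.pi), ENNReal.ofReal (‖Complex.exp (θ * Complex.I) - η‖ ^ (δ - 1))
        ≤ ∫⁻ θ in Ioc 0 (2 * Real.pi), (ker1 δ (θ - φ) + ker1 δ (θ - (φ + 2 * Real.pi))) := by
          apply setLIntegral_mono
          · have := ker1_meas δ
            fun_prop
          intro θ hθ
          have e : ‖Complex.exp (θ * Complex.I) - η‖ =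
              ‖Complex.exp (Complex.I * ((θ - φ : ℝ) : ℂ)) - 1‖ := by
            have : Complex.exp (θ * Complex.I) - η =
                (Complex.exp (Complex.I * ((θ - φ : ℝ) : ℂ)) - 1) * Complex.exp (φ * Complex.I) := by
              rw [hηφ, sub_mul, ← Complex.exp_add, one_mul]
              congr 2
              push_cast
              ring
            rw [this, norm_mul, Complex.norm_exp_ofReal_mul_I, mul_one]
          rw [e]
          have key : ∀ c : ℝ, (c = 0 ∨ c = 2 * Real.pi) → |θ - φ - c| ≤ Real.pi →
              ENNReal.ofReal (‖Complex.exp (Complex.I * ((θ - φ : ℝ) : ℂ)) - 1‖ ^ (δ - 1)) ≤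
              ker1 δ (θ - φ - c) := by
            intro c hc h
            have hl := chord_lower hc h
            apply ENNReal.ofReal_le_ofReal
            rcases (abs_nonneg (θ - φ - c)).eq_or_lt with h0 | h0
            · have h00 : θ - φ = c := by
                have := abs_eq_zero.1 h0.symm
                linarith
              have h1 : Complex.exp (Complex.I * ((θ - φ : ℝ) : ℂ)) = 1 := by
                rw [h00]
                rcases hc with rfl | rfl
                · simp
                · rw [Complex.exp_eq_one_iff]
                  exact ⟨1, by push_cast; ring⟩
              rw [h1, sub_self, norm_zero, Real.zero_rpow (by linarith)]
              positivity
            · exact Real.rpow_le_rpow_of_nonpos (by positivity) hl (by linarith)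
          rcases le_or_gt (θ - φ) Real.pi with h | h
          · refine (key 0 (Or.inl rfl) ?_).trans ?_
            · rw [sub_zero, abs_le]
              constructor <;> linarith [hθ.1]
            · rw [sub_zero]
              exact le_self_add
          · refine (key (2 * Real.pi) (Or.inr rfl) ?_).trans ?_
            · rw [abs_le]
              constructor <;> linarith [hθ.2]
            · rw [sub_sub]
              exact le_add_self
      _ = (∫⁻ θ in Ioc 0 (2 * Real.pi), ker1 δ (θ - φ)) +
          ∫⁻ θ in Ioc 0 (2 * Real.pi), ker1 δ (θ - (φ + 2 * Real.pi)) := by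
          apply lintegral_add_left
          have := ker1_meas δ
          fun_prop
      _ ≤ J + J := by
          gcongr
          · exact ker1_shift ⟨hφ1.le, by linarith⟩
          · exact ker1_shift ⟨by linarith, by linarith⟩

lemma holder_cont {G : ℂ → ℂ} {K δ : ℝ} (hδ : 0 < δ)
    (hG : ∀ z w : ℂ, ‖z‖ ≤ 1 → ‖w‖ ≤ 1 → ‖G z - G w‖ ≤ K * ‖z - w‖ ^ δ) :
    ContinuousOn G (closedBall (0 : ℂ) 1) := by
  intro z hz
  have hz' : ‖z‖ ≤ 1 := by simpa using hz
  rw [ContinuousWithinAt, tendsto_iff_norm_sub_tendsto_zero]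
  have h0 : Filter.Tendsto (fun w : ℂ => K * ‖w - z‖ ^ δ) (nhdsWithin z (closedBall 0 1))
      (nhds 0) := by
    have hc : Continuous (fun w : ℂ => K * ‖w - z‖ ^ δ) := by
      have := Real.continuous_rpow_const hδ.le
      exact continuous_const.mul (this.comp (by fun_prop))
    have := hc.tendsto z
    simp only [sub_self, norm_zero, Real.zero_rpow hδ.ne', mul_zero] at this
    exact this.mono_left nhdsWithin_le_nhds
  apply squeeze_zero' (Filter.Eventually.of_forall fun _ => norm_nonneg _) _ h0
  filter_upwards [self_mem_nhdsWithin] with w hw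
  exact hG w z (by simpa using hw) hz'

lemma holder_quot {G : ℂ → ℂ} {K δ : ℝ}
    (hG : ∀ z w : ℂ, ‖z‖ ≤ 1 → ‖w‖ ≤ 1 → ‖G z - G w‖ ≤ K * ‖z - w‖ ^ δ) {z w : ℂ}
    (hK : 0 ≤ K) (hz : ‖z‖ ≤ 1) (hw : ‖w‖ ≤ 1) :
    ‖G z - G w‖ / ‖z - w‖ ≤ K * ‖z - w‖ ^ (δ - 1) := by
  rcases (norm_nonneg (z - w)).eq_or_lt with h | h
  · rw [← h, div_zero]; positivity
  · rw [div_le_iff₀ h, mul_assoc, ← Real.rpow_add_one h.ne', sub_add_cancel]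
    exact hG z w hz hw

lemma sphere_dist {ζ η : ℂ} (hζ : ‖ζ‖ = 1) (hη : ‖η‖ = 1) {r : ℝ} (hr0 : 0 ≤ r) (hr : r < 1) :
    ‖ζ - η‖ / 2 ≤ ‖1 - (starRingEnd ℂ) ζ * (r * η)‖ := by
  have e : ‖1 - (starRingEnd ℂ) ζ * (r * η)‖ = ‖ζ - r * η‖ := by
    have h1 : ζ * (starRingEnd ℂ) ζ = 1 := by
      rw [Complex.mul_conj, Complex.normSq_eq_norm_sq, hζ]; simp
    have : ζ - r * η = ζ * (1 - (starRingEnd ℂ) ζ * (r * η)) := by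
      linear_combination (r * η) * h1
    rw [this, norm_mul, hζ, one_mul]
  rw [e]
  have h1 : ‖(r : ℂ) * η‖ = r := by simp [hη, abs_of_nonneg hr0]
  have h2 : 1 - r ≤ ‖ζ - r * η‖ := by
    have := norm_sub_norm_le ζ (r * η)
    rwa [h1, hζ] at this
  have h3 : ‖ζ - η‖ ≤ ‖ζ - r * η‖ + ‖r * η - η‖ := norm_sub_le_norm_sub_add_norm_sub _ _ _
  have h4 : ‖r * η - η‖ = 1 - r := by
    have : r * η - η = ((r - 1 : ℝ) : ℂ) * η := by push_cast; ring
    rw [this, norm_mul, hη, mul_one, Complex.norm_real, Real.norm_eq_abs, abs_sub_comm,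
      abs_of_nonneg (by linarith)]
  linarith

lemma toeplitz_pt {G : ℂ → ℂ} {M K δ : ℝ} (hK : 0 ≤ K) (hδ : 0 < δ)
    (hGM : ∀ z : ℂ, ‖z‖ ≤ 1 → ‖G z‖ ≤ M)
    (hG : ∀ z w : ℂ, ‖z‖ ≤ 1 → ‖w‖ ≤ 1 → ‖G z - G w‖ ≤ K * ‖z - w‖ ^ δ)
    {h hs : ℂ → ℂ} (hh : DifferentiableOn ℂ h (ball 0 1))
    (hn : hardyNorm 1 h ≠ ⊤) (hb : IsBoundaryFn h hs) {η : ℂ} (hη : ‖η‖ = 1) {r : ℝ}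
    (hr0 : 0 ≤ r) (hr : r < 1) :
    ‖toeplitz G hs (r * η)‖ₑ ≤ ENNReal.ofReal M * ‖h (r * η)‖ₑ +
      ∫⁻ ζ, ENNReal.ofReal (2 * K) * (ENNReal.ofReal (‖ζ - η‖ ^ (δ - 1)) * ‖hs ζ‖ₑ)
        ∂circleMeasure := by
  have hz : (r : ℂ) * η ∈ ball (0 : ℂ) 1 := by simp [hη, abs_of_nonneg hr0, hr]
  have hGc := (holder_cont hδ hG).mono sphere_subset_closedBall
  have ihs := bdry_integrable hh hn hb
  have hbd : ∀ F : ℂ → ℂ, ContinuousOn F (sphere 0 1) →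
      Integrable (fun ζ => F ζ * hs ζ) circleMeasure := by
    intro F hF
    obtain ⟨C, hC⟩ := (isCompact_sphere (0 : ℂ) 1).exists_bound_of_continuousOn hF
    apply ihs.bdd_mul (c := C) (cm_aesm hF)
    filter_upwards [cm_norm] with ζ hζ using hC ζ (by simpa using hζ)
  have hk := kern_cont hz
  have i1 := hbd (fun ζ => (starRingEnd ℂ) (G ζ - G η) * (1 - (starRingEnd ℂ) ζ * (r * η))⁻¹)
    ((Complex.continuous_conj.comp_continuousOn (hGc.sub continuousOn_const)).mul hk)
  have i2 := hbd (fun ζ => (starRingEnd ℂ) (G η) * (1 - (starRingEnd ℂ) ζ * (r * η))⁻¹)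
    (continuousOn_const.mul hk)
  have e : toeplitz G hs (r * η) = (starRingEnd ℂ) (G η) * h (r * η) +
      ∫ ζ, (starRingEnd ℂ) (G ζ - G η) * (1 - (starRingEnd ℂ) ζ * (r * η))⁻¹ * hs ζ
        ∂circleMeasure := by
    rw [← cauchy_formula hh hn hb hz, ← integral_const_mul, toeplitz]
    have i2' : Integrable (fun ζ => (starRingEnd ℂ) (G η) *
        (hs ζ * (1 - (starRingEnd ℂ) ζ * (r * η))⁻¹)) circleMeasure := by
      refine i2.congr (Filter.Eventually.of_forall fun ζ => ?_)
      simp only; ring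
    rw [← integral_add i2' i1]
    apply integral_congr_ae
    refine Filter.Eventually.of_forall fun ζ => ?_
    simp only [map_sub]
    rw [div_eq_mul_inv]
    ring
  rw [e]
  refine (enorm_add_le _ _).trans (add_le_add ?_ ((enorm_integral_le_lintegral_enorm _).trans ?_))
  · rw [enorm_mul]
    gcongr
    rw [← ofReal_norm]
    apply ENNReal.ofReal_le_ofReal
    rw [RCLike.norm_conj]
    exact hGM η hη.le
  · apply lintegral_mono_ae
    filter_upwards [cm_norm] with ζ hζ
    rw [enorm_mul, ← mul_assoc (ENNReal.ofReal (2 * K))]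
    gcongr
    rw [← ENNReal.ofReal_mul (by positivity), ← ofReal_norm]
    apply ENNReal.ofReal_le_ofReal
    rw [norm_mul, RCLike.norm_conj, norm_inv]
    have hq := holder_quot hG hK hζ.le hη.le
    have hd := sphere_dist hζ hη hr0 hr
    rcases (norm_nonneg (ζ - η)).eq_or_lt with h0 | h0
    · have : ζ = η := by rw [← sub_eq_zero]; exact norm_eq_zero.1 h0.symm
      rw [this, sub_self, norm_zero, zero_mul]; positivity
    · calc ‖G ζ - G η‖ * ‖1 - (starRingEnd ℂ) ζ * (r * η)‖⁻¹
          ≤ ‖G ζ - G η‖ * (‖ζ - η‖ / 2)⁻¹ := by gcongr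
        _ = 2 * (‖G ζ - G η‖ / ‖ζ - η‖) := by rw [inv_div]; ring
        _ ≤ 2 * (K * ‖ζ - η‖ ^ (δ - 1)) := by gcongr
        _ = _ := by ring

lemma toeplitz_h1 {G : ℂ → ℂ} {M K δ : ℝ} (hK : 0 ≤ K) (hδ : 0 < δ)
    (hGM : ∀ z : ℂ, ‖z‖ ≤ 1 → ‖G z‖ ≤ M)
    (hG : ∀ z w : ℂ, ‖z‖ ≤ 1 → ‖w‖ ≤ 1 → ‖G z - G w‖ ≤ K * ‖z - w‖ ^ δ)
    {J : ℝ≥0∞} (hJ : ∀ η : ℂ, ‖η‖ = 1 →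
      ∫⁻ ζ, ENNReal.ofReal (‖ζ - η‖ ^ (δ - 1)) ∂circleMeasure ≤ J)
    {h hs : ℂ → ℂ} (hh : DifferentiableOn ℂ h (ball 0 1))
    (hn : hardyNorm 1 h ≠ ⊤) (hb : IsBoundaryFn h hs) :
    hardyNorm 1 (toeplitz G hs) ≤
      (ENNReal.ofReal M + ENNReal.ofReal (2 * K) * J) * hardyNorm 1 h := by
  conv_lhs => unfold hardyNorm
  refine iSup₂_le fun r hr => ?_
  have hm : AEMeasurable (fun ζ => ‖h (r * ζ)‖ₑ) circleMeasure := (dil_aesm hh hr).enorm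
  have hms : AEMeasurable (fun ζ => ‖hs ζ‖ₑ) circleMeasure := (bdry_aesm hh hb).enorm
  calc ∫⁻ η, ENNReal.ofReal (‖toeplitz G hs (r * η)‖ ^ (1 : ℝ)) ∂circleMeasure
      ≤ ∫⁻ η, (ENNReal.ofReal M * ‖h (r * η)‖ₑ +
          ∫⁻ ζ, ENNReal.ofReal (2 * K) * (ENNReal.ofReal (‖ζ - η‖ ^ (δ - 1)) * ‖hs ζ‖ₑ)
            ∂circleMeasure) ∂circleMeasure := by
        apply lintegral_mono_ae
        filter_upwards [cm_norm] with η hη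
        rw [Real.rpow_one, ofReal_norm]
        exact toeplitz_pt hK hδ hGM hG hh hn hb hη hr.1.le hr.2
    _ = ENNReal.ofReal M * (∫⁻ η, ‖h (r * η)‖ₑ ∂circleMeasure) +
          ∫⁻ η, ∫⁻ ζ, ENNReal.ofReal (2 * K) * (ENNReal.ofReal (‖ζ - η‖ ^ (δ - 1)) * ‖hs ζ‖ₑ)
            ∂circleMeasure ∂circleMeasure := by
        rw [lintegral_add_left' (hm.const_mul _), lintegral_const_mul'' _ hm]
    _ = ENNReal.ofReal M * (∫⁻ η, ‖h (r * η)‖ₑ ∂circleMeasure) +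
          ∫⁻ ζ, ∫⁻ η, ENNReal.ofReal (2 * K) * (ENNReal.ofReal (‖ζ - η‖ ^ (δ - 1)) * ‖hs ζ‖ₑ)
            ∂circleMeasure ∂circleMeasure := by
        congr 1
        apply lintegral_lintegral_swap
        apply AEMeasurable.const_mul
        refine AEMeasurable.fun_mul ?_ ?_
        · apply Measurable.aemeasurable
          fun_prop
        · exact hms.comp_snd
    _ ≤ ENNReal.ofReal M * hardyNorm 1 h +
          ∫⁻ ζ, ENNReal.ofReal (2 * K) * J * ‖hs ζ‖ₑ ∂circleMeasure := by
        gcongr ENNReal.ofReal M * ?_ + ?_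
        · exact hardy_le hr
        · apply lintegral_mono_ae
          filter_upwards [cm_norm] with ζ hζ
          rw [lintegral_const_mul _ (by fun_prop), lintegral_mul_const _ (by fun_prop), mul_assoc]
          gcongr
          simp_rw [norm_sub_rev ζ]
          exact hJ ζ hζ
    _ ≤ ENNReal.ofReal M * hardyNorm 1 h + ENNReal.ofReal (2 * K) * J * hardyNorm 1 h := by
        rw [lintegral_const_mul'' _ hms]
        gcongr
        exact bdry_fatou hh hb
    _ = _ := by rw [add_mul]

lemma eSup_le {h : ℂ → ℂ} {z : ℂ} (hz : z ∈ ball (0 : ℂ) 1) : ‖h z‖ₑ ≤ eSupAbs h := by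
  rw [← ofReal_norm]
  exact le_iSup₂ (f := fun (z : ℂ) (_ : z ∈ ball (0 : ℂ) 1) => ENNReal.ofReal ‖h z‖) z hz

lemma dil_mem {ζ : ℂ} (hζ : ‖ζ‖ = 1) {r : ℝ} (hr : r ∈ Ioo (0 : ℝ) 1) :
    (r : ℂ) * ζ ∈ ball (0 : ℂ) 1 := by
  simp [hζ, abs_of_pos hr.1, hr.2]

lemma hardy_le_eSup (h : ℂ → ℂ) : hardyNorm 1 h ≤ eSupAbs h := by
  unfold hardyNorm
  refine iSup₂_le fun r hr => ?_
  calc ∫⁻ ζ, ENNReal.ofReal (‖h (r * ζ)‖ ^ (1 : ℝ)) ∂circleMeasure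
      ≤ ∫⁻ _, eSupAbs h ∂circleMeasure := by
        apply lintegral_mono_ae
        filter_upwards [cm_norm] with ζ hζ
        rw [Real.rpow_one, ofReal_norm]
        exact eSup_le (dil_mem hζ hr)
    _ = eSupAbs h := by simp

lemma bdry_le_eSup {h hs : ℂ → ℂ} (hb : IsBoundaryFn h hs) :
    ∀ᵐ ζ ∂circleMeasure, ‖hs ζ‖ₑ ≤ eSupAbs h := by
  filter_upwards [bdry_seq hb, cm_norm] with ζ h1 h2
  exact le_of_tendsto' h1.enorm fun k => eSup_le (dil_mem h2 (rad_mem k))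

lemma toeplitz_hinf {G : ℂ → ℂ} {M K δ : ℝ} (hK : 0 ≤ K) (hδ : 0 < δ)
    (hGM : ∀ z : ℂ, ‖z‖ ≤ 1 → ‖G z‖ ≤ M)
    (hG : ∀ z w : ℂ, ‖z‖ ≤ 1 → ‖w‖ ≤ 1 → ‖G z - G w‖ ≤ K * ‖z - w‖ ^ δ)
    {J : ℝ≥0∞} (hJ : ∀ η : ℂ, ‖η‖ = 1 →
      ∫⁻ ζ, ENNReal.ofReal (‖ζ - η‖ ^ (δ - 1)) ∂circleMeasure ≤ J)
    {h hs : ℂ → ℂ} (hh : DifferentiableOn ℂ h (ball 0 1))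
    (hn : eSupAbs h ≠ ⊤) (hb : IsBoundaryFn h hs) :
    eSupAbs (toeplitz G hs) ≤
      (ENNReal.ofReal M + ENNReal.ofReal (2 * K) * J) * eSupAbs h := by
  have hn1 : hardyNorm 1 h ≠ ⊤ := ne_top_of_le_ne_top hn (hardy_le_eSup h)
  conv_lhs => unfold eSupAbs
  refine iSup₂_le fun z hz => ?_
  have hz' : ‖z‖ < 1 := by simpa using hz
  obtain ⟨η, hη, hzη⟩ : ∃ η : ℂ, ‖η‖ = 1 ∧ z = (‖z‖ : ℝ) * η := by
    refine ⟨Complex.exp (Complex.arg z * Complex.I), Complex.norm_exp_ofReal_mul_I _,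
      (Complex.norm_mul_exp_arg_mul_I z).symm⟩
  have key := toeplitz_pt hK hδ hGM hG hh hn1 hb hη (norm_nonneg z) hz'
  rw [← hzη] at key
  rw [ofReal_norm]
  refine key.trans ?_
  rw [add_mul]
  gcongr ENNReal.ofReal M * ?_ + ?_
  · exact eSup_le hz
  · calc ∫⁻ ζ, ENNReal.ofReal (2 * K) * (ENNReal.ofReal (‖ζ - η‖ ^ (δ - 1)) * ‖hs ζ‖ₑ)
          ∂circleMeasure
        ≤ ∫⁻ ζ, ENNReal.ofReal (2 * K) * (ENNReal.ofReal (‖ζ - η‖ ^ (δ - 1)) * eSupAbs h)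
          ∂circleMeasure := by
          apply lintegral_mono_ae
          filter_upwards [bdry_le_eSup hb] with ζ hζ
          gcongr
      _ ≤ _ := by
          rw [lintegral_const_mul _ (by fun_prop), lintegral_mul_const _ (by fun_prop), mul_assoc]
          gcongr
          exact hJ η hη

lemma lam_bound {G : ℂ → ℂ} {K δ : ℝ} (hK : 0 ≤ K)
    (hG : ∀ z w : ℂ, ‖z‖ ≤ 1 → ‖w‖ ≤ 1 → ‖G z - G w‖ ≤ K * ‖z - w‖ ^ δ)
    {J : ℝ≥0∞} (hJ : ∀ η : ℂ, ‖η‖ = 1 →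
      ∫⁻ ζ, ENNReal.ofReal (‖ζ - η‖ ^ (δ - 1)) ∂circleMeasure ≤ J) :
    Lam G ≤ ENNReal.ofReal K * J := by
  refine essSup_le_of_ae_le _ ?_
  filter_upwards [cm_norm] with η hη
  calc ∫⁻ ζ, ENNReal.ofReal (‖G ζ - G η‖ / ‖ζ - η‖) ∂circleMeasure
      ≤ ∫⁻ ζ, ENNReal.ofReal K * ENNReal.ofReal (‖ζ - η‖ ^ (δ - 1)) ∂circleMeasure := by
        apply lintegral_mono_ae
        filter_upwards [cm_norm] with ζ hζ
        rw [← ENNReal.ofReal_mul hK]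
        exact ENNReal.ofReal_le_ofReal (holder_quot hG hK hζ.le hη.le)
    _ ≤ _ := by
        rw [lintegral_const_mul _ (by fun_prop)]
        gcongr
        exact hJ η hη

/-- **Theorem 3, first sequence.** For `ε > 0` and `α_n = 1/(n+1)^ε`, for every `f ∈ H^∞` the function `f*α` belongs to `𝔑` and the Toeplitz operator `T_{f*α}` is bounded on `H^1` and on `H^∞`. -/
theorem theorem3_power_sequence (ε : ℝ) (hε : 0 < ε) (f : ℂ → ℂ)
    (hf : DifferentiableOn ℂ f (Metric.ball (0 : ℂ) 1))
    (hfb : eSupAbs f ≠ ⊤) :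
    ∃ gs : ℂ → ℂ,
      IsBoundaryFn (seqConv f (fun n : ℕ => 1 / ((n : ℝ) + 1) ^ ε)) gs ∧
      DifferentiableOn ℂ (seqConv f (fun n : ℕ => 1 / ((n : ℝ) + 1) ^ ε)) (Metric.ball (0 : ℂ) 1) ∧
      eSupAbs (seqConv f (fun n : ℕ => 1 / ((n : ℝ) + 1) ^ ε)) ≠ ⊤ ∧
      Lam gs ≠ ⊤ ∧
      ∃ C : ℝ≥0∞, C ≠ ⊤ ∧
        (∀ h hs : ℂ → ℂ,
          DifferentiableOn ℂ h (Metric.ball (0 : ℂ) 1) →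
          hardyNorm 1 h ≠ ⊤ →
          IsBoundaryFn h hs →
          Integrable hs circleMeasure →
          hardyNorm 1 (toeplitz gs hs) ≤ C * hardyNorm 1 h) ∧
        (∀ h hs : ℂ → ℂ,
          DifferentiableOn ℂ h (Metric.ball (0 : ℂ) 1) →
          eSupAbs h ≠ ⊤ →
          IsBoundaryFn h hs →
          eSupAbs (toeplitz gs hs) ≤ C * eSupAbs h) := by
  set M := (eSupAbs f).toReal with hMdef
  have hM : ∀ z ∈ ball (0 : ℂ) 1, ‖f z‖ ≤ M := by
    intro z hz
    have := ENNReal.toReal_mono hfb (eSup_le (h := f) hz)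
    rwa [toReal_enorm] at this
  set δ : ℝ := min ε 1 / 2 with hδdef
  have hm : 0 < min ε 1 := lt_min hε one_pos
  have hδ0 : 0 < δ := by positivity
  have hδ1 : δ < 1 := by have := min_le_right ε 1; linarith
  have hδε : δ < ε := by have := min_le_left ε 1; linarith
  obtain ⟨K, hK, hG⟩ := Gf_holder hf hM hδ0 hδ1.le hδε
  obtain ⟨J, hJtop, hJ⟩ := kern_bound hδ0 hδ1
  have hGM : ∀ z : ℂ, ‖z‖ ≤ 1 → ‖Gf ε f z‖ ≤ M := fun z hz => Gf_bound hε hM hz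
  refine ⟨Gf ε f, ?_, seqConv_diff hε hf, ?_, ?_,
    ENNReal.ofReal M + ENNReal.ofReal (2 * K) * J, ?_, ?_, ?_⟩
  · filter_upwards [cm_norm] with ζ hζ
    have hc := holder_cont hδ0 hG ζ (by simp [hζ])
    have ht : Filter.Tendsto (fun r : ℝ => (r : ℂ) * ζ) (nhdsWithin 1 (Set.Iio 1))
        (nhdsWithin ζ (closedBall 0 1)) := by
      apply tendsto_nhdsWithin_of_tendsto_nhds_of_eventually_within
      · have : Continuous (fun r : ℝ => (r : ℂ) * ζ) := by fun_prop
        have := this.tendsto 1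
        simp only [ofReal_one, one_mul] at this
        exact this.mono_left nhdsWithin_le_nhds
      · filter_upwards [Ioo_mem_nhdsLT (zero_lt_one (α := ℝ))] with r hr
        exact ball_subset_closedBall (dil_mem hζ hr)
    refine (Filter.Tendsto.comp hc ht).congr' ?_
    filter_upwards [Ioo_mem_nhdsLT (zero_lt_one (α := ℝ))] with r hr
    exact (seqConv_eq_Gf hε hf (dil_mem hζ hr)).symm
  · refine ne_top_of_le_ne_top (ENNReal.ofReal_ne_top (r := M)) (iSup₂_le fun z hz => ?_)
    rw [seqConv_eq_Gf hε hf hz]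
    have hz' : ‖z‖ < 1 := by simpa using hz
    exact ENNReal.ofReal_le_ofReal (hGM z hz'.le)
  · exact ne_top_of_le_ne_top (ENNReal.mul_ne_top ENNReal.ofReal_ne_top hJtop)
      (lam_bound hK hG hJ)
  · exact ENNReal.add_ne_top.2 ⟨ENNReal.ofReal_ne_top,
      ENNReal.mul_ne_top ENNReal.ofReal_ne_top hJtop⟩
  · intro h hs hh hn hb _
    exact toeplitz_h1 hK hδ0 hGM hG hJ hh hn hb
  · intro h hs hh hn hb
    exact toeplitz_hinf hK hδ0 hGM hG hJ hh hn hb
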